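/- Given M > 0, the following holds provided α > 0 is small enough. Let X : [0,1) → B_α be an admissible curve with return times n_k. For any finite sequence of integers 0 ≤ k₁ < k₂ < ⋯ < k_t, the set 𝒟(k₁,…,k_t) = {θ ∈ [0,1) : n_{k_i+1}(θ) − n_{k_i}(θ) ≤ N(α) + M for all 1 ≤ i ≤ t} has Lebesgue measure at most (2/3)^t. -/

import Mathlib

open Set MeasureTheory Filter
open scoped ENNReal

noncomputable section

/-- The quadratic map `f(x) = a - x²`. -/
def qm (a : ℝ) : ℝ → ℝ := fun x => a - x ^ 2

/-- The critical point `0` of `qm a` is strictly pre-periodic: its forward orbit never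
returns to `0` and is eventually periodic. -/
def StrictlyPreperiodic (a : ℝ) : Prop :=
  (∀ i : ℕ, 1 ≤ i → (qm a)^[i] 0 ≠ 0) ∧
    ∃ m p : ℕ, 1 ≤ m ∧ 1 ≤ p ∧ (qm a)^[m + p] 0 = (qm a)^[m] 0

/-- A lift of the Viana skew product `F(θ, x) = (dθ, f(x) + αφ(θ))` to `ℝ × ℝ`;
for `φ` of period `1` this is a lift of the corresponding map of `(ℝ/ℤ) × ℝ`. -/
def Viana (a : ℝ) (d : ℕ) (φ : ℝ → ℝ) (α : ℝ) : ℝ × ℝ → ℝ × ℝ :=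
  fun p => ((d : ℝ) * p.1, qm a p.2 + α * φ p.1)

/-- The fibre maps `f_n`, defined by `F^n(θ, x) = (d^n θ, f_n(θ, x))`. -/
def fn (a : ℝ) (d : ℕ) (φ : ℝ → ℝ) (α : ℝ) (n : ℕ) (θ x : ℝ) : ℝ :=
  ((Viana a d φ α)^[n] (θ, x)).2

/-- Endpoints of the shadowing intervals: `IEnd a α n` gives the endpoints of `I_{n+1}`, where
`I₁ = [c₁ - 2α, c₁ + 2α]` and `I_{n+1}` is the closed interval containing `f(I_n)` both of whose
complementary components in `I_{n+1}` have length `α`. -/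
def IEnd (a α : ℝ) : ℕ → ℝ × ℝ
  | 0 => (qm a 0 - 2 * α, qm a 0 + 2 * α)
  | n + 1 =>
      (sInf (qm a '' Set.Icc (IEnd a α n).1 (IEnd a α n).2) - α,
        sSup (qm a '' Set.Icc (IEnd a α n).1 (IEnd a α n).2) + α)

/-- The shadowing interval `I_n`, for `n ≥ 1`. -/
def Iseq (a α : ℝ) (n : ℕ) : Set ℝ := Set.Icc (IEnd a α (n - 1)).1 (IEnd a α (n - 1)).2

/-- The length `|I_{n+1}|` of the shadowing interval `I_{n+1}`. -/
def len (a α : ℝ) (n : ℕ) : ℝ := (IEnd a α n).2 - (IEnd a α n).1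

/-- `N(α)`: the maximal integer `N` such that `|I_n| < ξ₀` for all `1 ≤ n ≤ N` and
`∑_{n=1}^{N} |I_n| ≤ ξ₀`. -/
def Nal (a ξ₀ α : ℝ) : ℕ :=
  sSup {N : ℕ | (∀ n : ℕ, 1 ≤ n → n ≤ N → len a α (n - 1) < ξ₀) ∧
    ∑ n ∈ Finset.range N, len a α n ≤ ξ₀}

/-- A curve `X : [0,1) → B = [-β, β]` is admissible if it is the image of a horizontal curve
under `F^n` for some `n ≥ n₀ + 1`: there are `ω = [j/dⁿ, (j+1)/dⁿ) ∈ 𝒫_n` and `x₀ ∈ B` with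
`X(dⁿθ mod 1) = f_n(θ, x₀)` for all `θ ∈ ω`; equivalently `X(t) = f_n((t+j)/dⁿ, x₀)` on `[0,1)`. -/
def Admissible (a : ℝ) (d : ℕ) (φ : ℝ → ℝ) (α β : ℝ) (n₀ : ℕ) (X : ℝ → ℝ) : Prop :=
  ∃ n : ℕ, n₀ + 1 ≤ n ∧ ∃ j : ℕ, j < d ^ n ∧ ∃ x₀ ∈ Set.Icc (-β) β,
    ∀ θ ∈ Set.Ico (0 : ℝ) 1, X θ = fn a d φ α n ((θ + j) / (d : ℝ) ^ n) x₀

/-- `IsRet … X θ n` holds iff `n = 0` or `n` is a return time of `θ` for the curve `X`: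
there is `θ'` in the same element of the partition `𝒫_n` of `[0,1)` as `θ` with
`|f_n(θ', X(θ'))| ≤ α^{0.6}`. -/
def IsRet (a : ℝ) (d : ℕ) (φ : ℝ → ℝ) (α : ℝ) (X : ℝ → ℝ) (θ : ℝ) (n : ℕ) : Prop :=
  n = 0 ∨ 1 ≤ n ∧ ∃ θ' ∈ Set.Ico (0 : ℝ) 1,
    ⌊θ' * (d : ℝ) ^ n⌋ = ⌊θ * (d : ℝ) ^ n⌋ ∧ |fn a d φ α n θ' (X θ')| ≤ α ^ (0.6 : ℝ)

/-- `n_k(θ)` is defined, i.e. `{0} ∪ {return times of θ}` has more than `k` elements. -/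
def NkDef (a : ℝ) (d : ℕ) (φ : ℝ → ℝ) (α : ℝ) (X : ℝ → ℝ) (θ : ℝ) (k : ℕ) : Prop :=
  {n : ℕ | IsRet a d φ α X θ n}.Infinite ∨ k < {n : ℕ | IsRet a d φ α X θ n}.ncard

/-- `n_k(θ)`: the `k`-th smallest element of `{0} ∪ {return times of θ}` (so `n₀(θ) = 0`). -/
def nk (a : ℝ) (d : ℕ) (φ : ℝ → ℝ) (α : ℝ) (X : ℝ → ℝ) (θ : ℝ) (k : ℕ) : ℕ :=
  Nat.nth (IsRet a d φ α X θ) k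

lemma continuous_qm_iterate (a : ℝ) (n : ℕ) : Continuous (qm a)^[n] := by
  have : Continuous (qm a) := by unfold qm; fun_prop
  exact this.iterate n

lemma qm_iterate_sub (a x y : ℝ) (n : ℕ) :
    (qm a)^[n] x - (qm a)^[n] y =
      (∏ i ∈ Finset.range n, -((qm a)^[i] x + (qm a)^[i] y)) * (x - y) := by
  induction n with
  | zero => simp
  | succ n ih =>
    rw [Function.iterate_succ_apply', Function.iterate_succ_apply', Finset.prod_range_succ,
      mul_right_comm, ← ih]
    simp only [qm]
    ring

/-- If the orbit of `x` stays weakly on the same side of `0` as the orbit of `z`, then the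
secant slope of an orientation preserving branch of an iterate is positive. -/
lemma secant_pos {a x z : ℝ} {P : ℕ} (hpos : 0 < ∏ i ∈ Finset.range P, -(2 * (qm a)^[i] z))
    (hs : ∀ i < P, 0 ≤ (qm a)^[i] z * (qm a)^[i] x) :
    0 < ∏ i ∈ Finset.range P, -((qm a)^[i] x + (qm a)^[i] z) := by
  have hz : ∀ i < P, (qm a)^[i] z ≠ 0 := by
    intro i hi h0
    apply hpos.ne'
    apply Finset.prod_eq_zero (Finset.mem_range.2 hi)
    simp [h0]
  have : 0 < (∏ i ∈ Finset.range P, -((qm a)^[i] x + (qm a)^[i] z)) *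
      ∏ i ∈ Finset.range P, -(2 * (qm a)^[i] z) := by
    rw [← Finset.prod_mul_distrib]
    apply Finset.prod_pos
    intro i hi
    have h1 := hs i (Finset.mem_range.1 hi)
    have h2 := mul_self_pos.2 (hz i (Finset.mem_range.1 hi))
    nlinarith
  exact pos_of_mul_pos_left this hpos.le

/-- A critical point of an iterate at the end of a lap around a fixed point `z` cannot be attracted
to `z` monotonically when the critical point `0` has finite orbit. -/
lemma exists_not_attracted {a z v : ℝ} {P : ℕ}
    (hfin : (Set.range fun n : ℕ => (qm a)^[n] 0).Finite)
    (hfix : (qm a)^[P] z = z) (hpos : 0 < ∏ i ∈ Finset.range P, -(2 * (qm a)^[i] z))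
    (hvz : v ≠ z) (hcrit : ∃ i < P, (qm a)^[i] v = 0)
    (hs : ∀ s ∈ Set.Ioc (0 : ℝ) 1, ∀ i < P, 0 ≤ (qm a)^[i] z * (qm a)^[i] (z + s * (v - z))) :
    ∃ s ∈ Set.Ioc (0 : ℝ) 1,
      0 ≤ ((qm a)^[P] (z + s * (v - z)) - (z + s * (v - z))) * (v - z) := by
  by_contra! hcon
  have key : ∀ s ∈ Set.Ioc (0 : ℝ) 1, ∃ s' ∈ Set.Ioo (0 : ℝ) s,
      (qm a)^[P] (z + s * (v - z)) = z + s' * (v - z) := by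
    intro s hs1
    have h1 := secant_pos hpos (hs s hs1)
    have h2 := qm_iterate_sub a (z + s * (v - z)) z P
    rw [hfix] at h2
    set k := ∏ i ∈ Finset.range P, -((qm a)^[i] (z + s * (v - z)) + (qm a)^[i] z)
    have h3 := hcon s hs1
    have h4 : (qm a)^[P] (z + s * (v - z)) = z + k * s * (v - z) := by linear_combination h2
    refine ⟨k * s, ⟨mul_pos h1 hs1.1, ?_⟩, h4⟩
    rw [h4] at h3
    have h5 : 0 < (v - z) ^ 2 := by have := sub_ne_zero.2 hvz; positivity
    nlinarith
  have orbit : ∀ n : ℕ, ∃ s ∈ Set.Ioc (0 : ℝ) 1, ((qm a)^[P])^[n] v = z + s * (v - z) := by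
    intro n
    induction n with
    | zero => exact ⟨1, by norm_num, by simp⟩
    | succ n ih =>
      obtain ⟨s, hs1, h⟩ := ih
      obtain ⟨s', hs', h'⟩ := key s hs1
      exact ⟨s', ⟨hs'.1, hs'.2.le.trans hs1.2⟩, by rw [Function.iterate_succ_apply', h, h']⟩
  choose σ hσ hσv using orbit
  have hanti : StrictAnti σ := by
    apply strictAnti_nat_of_succ_lt
    intro n
    obtain ⟨s', hs', h'⟩ := key _ (hσ n)
    have : σ (n + 1) = s' := by
      have h1 := hσv (n + 1)
      rw [Function.iterate_succ_apply', hσv n, h'] at h1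
      have := sub_ne_zero.2 hvz
      have h2 : s' * (v - z) = σ (n + 1) * (v - z) := by linarith
      exact (mul_right_cancel₀ this h2).symm
    rw [this]; exact hs'.2
  obtain ⟨i, hi, hi0⟩ := hcrit
  have hinj : Function.Injective fun n : ℕ => ((qm a)^[P])^[n + 1] v := by
    intro m n hmn
    simp only [hσv] at hmn
    have h2 : σ (m + 1) * (v - z) = σ (n + 1) * (v - z) := by linarith
    have := hanti.injective (mul_right_cancel₀ (sub_ne_zero.2 hvz) h2)
    omega
  refine Set.infinite_range_of_injective hinj (hfin.subset ?_)
  rintro _ ⟨n, rfl⟩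
  refine ⟨P * (n + 1) - i, ?_⟩
  have hle : i ≤ P * (n + 1) := by nlinarith
  simp only
  rw [← Function.iterate_mul, ← hi0, ← Function.iterate_add_apply, Nat.sub_add_cancel hle]

/-- Between a fixed point `z` of an iterate and a preimage `e` of the boundary fixed point `-q`
there is a point of the lap of `z` which is not moved towards `z`. -/
lemma exists_lap_point {a z e q : ℝ} {P : ℕ}
    (hfin : (Set.range fun n : ℕ => (qm a)^[n] 0).Finite)
    (hfix : (qm a)^[P] z = z) (hpos : 0 < ∏ i ∈ Finset.range P, -(2 * (qm a)^[i] z))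
    (he : e = q ∨ e = -q) (hzq : |z| < q) (heq : (qm a)^[P] e = -q) :
    ∃ s ∈ Set.Ioc (0 : ℝ) 1, (∀ i < P, 0 ≤ (qm a)^[i] z * (qm a)^[i] (z + s * (e - z))) ∧
      0 ≤ ((qm a)^[P] (z + s * (e - z)) - (z + s * (e - z))) * (e - z) := by
  have hzq' := abs_lt.1 hzq
  have hez : e ≠ z := by rintro rfl; rcases he with h | h <;> linarith
  have hz : ∀ i < P, (qm a)^[i] z ≠ 0 := by
    intro i hi h0
    apply hpos.ne'
    apply Finset.prod_eq_zero (Finset.mem_range.2 hi)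
    simp [h0]
  have hcont : ∀ i, Continuous fun s : ℝ => (qm a)^[i] z * (qm a)^[i] (z + s * (e - z)) := by
    intro i
    have := continuous_qm_iterate a i
    fun_prop
  have hsign : ∀ s : ℝ, 0 ≤ s → (∀ t ∈ Set.Icc 0 s, ∀ i < P, (qm a)^[i] (z + t * (e - z)) ≠ 0) →
      ∀ i < P, 0 < (qm a)^[i] z * (qm a)^[i] (z + s * (e - z)) := by
    intro s hs hne i hi
    by_contra! hle
    have h0 : 0 < (qm a)^[i] z * (qm a)^[i] (z + 0 * (e - z)) := by
      simpa using mul_self_pos.2 (hz i hi)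
    obtain ⟨t, ht, ht0⟩ := intermediate_value_Icc' hs (hcont i).continuousOn ⟨hle, h0.le⟩
    exact mul_ne_zero (hz i hi) (hne t ht i hi) ht0
  let Z : Set ℝ := Set.Icc 0 1 ∩ ⋃ i ∈ Finset.range P, {s | (qm a)^[i] (z + s * (e - z)) = 0}
  have hZc : IsCompact Z := by
    apply isCompact_Icc.inter_right
    apply isClosed_biUnion_finset
    intro i _
    have := continuous_qm_iterate a i
    exact isClosed_eq (by fun_prop) continuous_const
  rcases Z.eq_empty_or_nonempty with hZ | hZ
  · have hne : ∀ t ∈ Set.Icc (0 : ℝ) 1, ∀ i < P, (qm a)^[i] (z + t * (e - z)) ≠ 0 := by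
      intro t ht i hi h0
      have : t ∈ Z := ⟨ht, by simp only [Set.mem_iUnion]; exact ⟨i, Finset.mem_range.2 hi, h0⟩⟩
      rw [hZ] at this; exact this
    have h1 := hsign 1 zero_le_one hne
    refine ⟨1, by norm_num, fun i hi => (h1 i hi).le, ?_⟩
    have h2 := secant_pos hpos fun i hi => (h1 i hi).le
    have h3 := qm_iterate_sub a (z + 1 * (e - z)) z P
    have h4 : z + 1 * (e - z) = e := by ring
    rw [h4] at h2 h3 ⊢
    rw [hfix, heq] at h3
    rw [heq]
    rcases he with rfl | rfl
    · nlinarith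
    · simp
  · obtain ⟨s₀, hs₀, hmin⟩ := hZc.exists_isLeast hZ
    obtain ⟨⟨h0, h1⟩, hs₀'⟩ := hs₀
    simp only [Set.mem_iUnion, Finset.mem_range, Set.mem_ofPred_eq, exists_prop] at hs₀'
    have hne : ∀ t, 0 ≤ t → t < s₀ → ∀ i < P, (qm a)^[i] (z + t * (e - z)) ≠ 0 := by
      intro t ht ht' i hi h0
      have : t ∈ Z := ⟨⟨ht, ht'.le.trans h1⟩, by
        simp only [Set.mem_iUnion]; exact ⟨i, Finset.mem_range.2 hi, h0⟩⟩
      exact absurd (hmin this) (not_le.2 ht')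
    have hs0pos : 0 < s₀ := by
      rcases h0.eq_or_lt with h | h
      · obtain ⟨i, hi, h'⟩ := hs₀'
        rw [← h] at h'
        simp at h'
        exact absurd h' (hz i hi)
      · exact h
    have hlt : ∀ s, 0 ≤ s → s < s₀ → ∀ i < P,
        0 < (qm a)^[i] z * (qm a)^[i] (z + s * (e - z)) := fun s hs hs' =>
      hsign s hs fun t ht => hne t ht.1 (ht.2.trans_lt hs')
    have hle : ∀ s, 0 ≤ s → s ≤ s₀ → ∀ i < P,
        0 ≤ (qm a)^[i] z * (qm a)^[i] (z + s * (e - z)) := by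
      intro s hs hs' i hi
      have hcl : IsClosed {s : ℝ | 0 ≤ (qm a)^[i] z * (qm a)^[i] (z + s * (e - z))} :=
        isClosed_le continuous_const (hcont i)
      have hsub : Set.Ico 0 s₀ ⊆ {s : ℝ | 0 ≤ (qm a)^[i] z * (qm a)^[i] (z + s * (e - z))} :=
        fun t ht => (hlt t ht.1 ht.2 i hi).le
      have := hcl.closure_subset_iff.2 hsub
      rw [closure_Ico hs0pos.ne] at this
      exact this ⟨hs, hs'⟩
    have hrw : ∀ s, z + s * (z + s₀ * (e - z) - z) = z + (s * s₀) * (e - z) := fun s => by ring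
    obtain ⟨s, hs, hF⟩ := exists_not_attracted (v := z + s₀ * (e - z)) hfin hfix hpos
      (by
        intro h
        have : s₀ * (e - z) = 0 := by linarith
        exact mul_ne_zero hs0pos.ne' (sub_ne_zero.2 hez) this) hs₀'
      (by
        intro s hs
        rw [hrw]
        exact hle _ (mul_nonneg hs.1.le h0) (mul_le_of_le_one_left h0 hs.2))
    rw [hrw] at hF
    refine ⟨s * s₀, ⟨mul_pos hs.1 hs0pos, mul_le_one₀ hs.2 h0 h1⟩,
      hle _ (mul_nonneg hs.1.le h0) (mul_le_of_le_one_left h0 hs.2), ?_⟩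
    have h5 : ∀ X : ℝ, X * (z + s₀ * (e - z) - z) = s₀ * (X * (e - z)) := fun X => by ring
    rw [h5] at hF
    exact nonneg_of_mul_nonneg_right hF hs0pos

lemma one_lt_multiplier_of_pos {a z q : ℝ} {P : ℕ} (hP : 0 < P)
    (hfin : (Set.range fun n : ℕ => (qm a)^[n] 0).Finite)
    (hfix : (qm a)^[P] z = z) (hpos : 0 < ∏ i ∈ Finset.range P, -(2 * (qm a)^[i] z))
    (hzq : |z| < q) (hq : (qm a)^[P] q = -q) (hq' : (qm a)^[P] (-q) = -q) :
    1 < ∏ i ∈ Finset.range P, -(2 * (qm a)^[i] z) := by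
  have hzq' := abs_lt.1 hzq
  obtain ⟨s, hs, hsv, hFv⟩ := exists_lap_point hfin hfix hpos (Or.inl rfl) hzq hq
  obtain ⟨r, hr, hru, hFu⟩ := exists_lap_point hfin hfix hpos (Or.inr rfl) hzq hq'
  have hvz : 0 < s * (q - z) := mul_pos hs.1 (by linarith)
  have huz : r * (-q - z) < 0 := mul_neg_of_pos_of_neg hr.1 (by linarith)
  set v := z + s * (q - z)
  set u := z + r * (-q - z)
  replace hvz : z < v := by simp only [v]; linarith
  replace huz : u < z := by simp only [u]; linarith
  replace hFv : v ≤ (qm a)^[P] v := by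
    have := nonneg_of_mul_nonneg_left hFv (by linarith : 0 < q - z)
    linarith
  replace hFu : (qm a)^[P] u ≤ u := by
    have := nonpos_of_mul_nonneg_left hFu (by linarith : -q - z < 0)
    linarith
  have hz : ∀ i < P, (qm a)^[i] z ≠ 0 := by
    intro i hi h0
    apply hpos.ne'
    apply Finset.prod_eq_zero (Finset.mem_range.2 hi)
    simp [h0]
  have hU := secant_pos hpos hru
  have hV := secant_pos hpos hsv
  have eU := qm_iterate_sub a u z P
  have eV := qm_iterate_sub a v z P
  have eK := qm_iterate_sub a u v P
  rw [hfix] at eU eV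
  have hkey : (∏ i ∈ Finset.range P, -((qm a)^[i] u + (qm a)^[i] z)) *
      (∏ i ∈ Finset.range P, -((qm a)^[i] v + (qm a)^[i] z)) <
      (∏ i ∈ Finset.range P, -(2 * (qm a)^[i] z)) *
      ∏ i ∈ Finset.range P, -((qm a)^[i] u + (qm a)^[i] v) := by
    have hopp : ∀ i < P, ((qm a)^[i] u - (qm a)^[i] z) * ((qm a)^[i] v - (qm a)^[i] z) < 0 := by
      intro i hi
      have h0 : 0 < (∏ j ∈ Finset.range i, -((qm a)^[j] u + (qm a)^[j] z)) *
          ∏ j ∈ Finset.range i, -((qm a)^[j] v + (qm a)^[j] z) := by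
        rw [← Finset.prod_mul_distrib]
        apply Finset.prod_pos
        intro j hj
        have hj' : j < P := (Finset.mem_range.1 hj).trans hi
        have h1 := hru j hj'
        have h2 := hsv j hj'
        have h3 := mul_self_pos.2 (hz j hj')
        rcases lt_or_gt_of_ne (hz j hj') with h | h
        · have := nonpos_of_mul_nonneg_right h1 h
          have := nonpos_of_mul_nonneg_right h2 h
          nlinarith
        · have := nonneg_of_mul_nonneg_right h1 h
          have := nonneg_of_mul_nonneg_right h2 h
          nlinarith
      rw [qm_iterate_sub, qm_iterate_sub a v z]
      have h4 : (u - z) * (v - z) < 0 := mul_neg_of_neg_of_pos (by linarith) (by linarith)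
      nlinarith
    rw [← Finset.prod_mul_distrib, ← Finset.prod_mul_distrib]
    apply Finset.prod_lt_prod
    · intro i hi
      have hi' := Finset.mem_range.1 hi
      have h1 := hru i hi'
      have h2 := hsv i hi'
      rcases lt_or_gt_of_ne (hz i hi') with h | h
      · have := nonpos_of_mul_nonneg_right h1 h
        have := nonpos_of_mul_nonneg_right h2 h
        nlinarith
      · have := nonneg_of_mul_nonneg_right h1 h
        have := nonneg_of_mul_nonneg_right h2 h
        nlinarith
    · intro i hi
      have := hopp i (Finset.mem_range.1 hi)
      nlinarith
    · refine ⟨0, Finset.mem_range.2 hP, ?_⟩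
      have := hopp 0 hP
      nlinarith
  set U := ∏ i ∈ Finset.range P, -((qm a)^[i] u + (qm a)^[i] z)
  set V := ∏ i ∈ Finset.range P, -((qm a)^[i] v + (qm a)^[i] z)
  set K := ∏ i ∈ Finset.range P, -((qm a)^[i] u + (qm a)^[i] v)
  set l := ∏ i ∈ Finset.range P, -(2 * (qm a)^[i] z)
  have hU1 : 1 ≤ U := by nlinarith
  have hV1 : 1 ≤ V := by nlinarith
  have hKe : K * (v - u) = V * (v - z) + U * (z - u) := by linarith
  have hK : K ≤ U * V := by
    have h1 : K * (v - u) ≤ U * V * (v - u) := by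
      rw [hKe]
      have : V * (v - z) ≤ U * V * (v - z) := by
        apply mul_le_mul_of_nonneg_right _ (by linarith); nlinarith
      have : U * (z - u) ≤ U * V * (z - u) := by
        apply mul_le_mul_of_nonneg_right _ (by linarith); nlinarith
      linarith
    exact le_of_mul_le_mul_right h1 (by linarith)
  have hKpos : 0 < K := pos_of_mul_pos_right ((mul_pos hU hV).trans hkey) hpos.le
  by_contra! hl
  have : l * K ≤ K := mul_le_of_le_one_left hKpos.le hl
  linarith

lemma range_iterate_finite_of_preperiodic {a : ℝ} (hpre : StrictlyPreperiodic a) :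
    (Set.range fun n : ℕ => (qm a)^[n] 0).Finite := by
  obtain ⟨-, m, p, hm, hp, h⟩ := hpre
  have hper : ∀ n, m ≤ n → (qm a)^[n + p] 0 = (qm a)^[n] 0 := by
    intro n hn
    obtain ⟨k, rfl⟩ := Nat.exists_eq_add_of_le' hn
    rw [add_assoc, Function.iterate_add_apply, h, ← Function.iterate_add_apply]
  apply ((Finset.range (m + p)).finite_toSet.image fun n : ℕ => (qm a)^[n] 0).subset
  rintro _ ⟨n, rfl⟩
  induction n using Nat.strong_induction_on with
  | _ n ih =>
    by_cases hn : n < m + p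
    · exact ⟨n, by simpa using hn, rfl⟩
    · have := hper (n - p) (by omega)
      rw [Nat.sub_add_cancel (by omega)] at this
      simp only [this]
      exact ih (n - p) (by omega)

/-- The cycle on which a strictly preperiodic critical point lands is repelling. -/
lemma one_lt_prod_of_preperiodic {a : ℝ} (ha : a ∈ Set.Ioo (1 : ℝ) 2)
    (hpre : StrictlyPreperiodic a) {m p : ℕ} (hm : 1 ≤ m) (hp : 1 ≤ p)
    (h : (qm a)^[m + p] 0 = (qm a)^[m] 0) :
    1 < ∏ i ∈ Finset.Ico m (m + p), 2 * |(qm a)^[i] 0| := by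
  have hfin := range_iterate_finite_of_preperiodic hpre
  set q : ℝ := (1 + √(1 + 4 * a)) / 2 with hqdef
  have hs : √(1 + 4 * a) ^ 2 = 1 + 4 * a := Real.sq_sqrt (by linarith [ha.1])
  have hs2 : 2 < √(1 + 4 * a) := by
    rw [Real.lt_sqrt (by norm_num)]; linarith [ha.1]
  have hq : q ^ 2 = q + a := by rw [hqdef]; nlinarith
  have hq1 : 1 < q := by rw [hqdef]; linarith
  have haq : a < q := by
    by_contra! hle
    nlinarith [ha.1, ha.2]
  have hbd : ∀ n, |(qm a)^[n] 0| < q := by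
    intro n
    induction n with
    | zero => simp; linarith
    | succ n ih =>
      rw [Function.iterate_succ_apply', qm]
      have := sq_lt_sq' (abs_lt.1 ih).1 (abs_lt.1 ih).2
      rw [abs_lt]
      constructor <;> nlinarith [sq_nonneg ((qm a)^[n] 0)]
  have hfq : qm a (-q) = -q := by simp only [qm]; linarith
  have hfq' : qm a q = -q := by simp only [qm]; linarith
  have hitq : ∀ n, (qm a)^[n] (-q) = -q := fun n => Function.iterate_fixed hfq n
  set z := (qm a)^[m] 0 with hzdef
  have hzp : (qm a)^[p] z = z := by
    rw [hzdef, ← Function.iterate_add_apply, add_comm, h]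
  have hzp2 : (qm a)^[p + p] z = z := by rw [Function.iterate_add_apply, hzp, hzp]
  have hz : ∀ i, (qm a)^[i] z ≠ 0 := by
    intro i
    rw [hzdef, ← Function.iterate_add_apply]
    exact hpre.1 _ (by omega)
  have hsq : ∏ i ∈ Finset.range (p + p), -(2 * (qm a)^[i] z) =
      (∏ i ∈ Finset.range p, -(2 * (qm a)^[i] z)) ^ 2 := by
    rw [Finset.prod_range_add, sq]
    congr 1
    apply Finset.prod_congr rfl
    intro i _
    rw [add_comm, Function.iterate_add_apply, hzp]
  have hne : (∏ i ∈ Finset.range p, -(2 * (qm a)^[i] z)) ≠ 0 := by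
    rw [Finset.prod_ne_zero_iff]
    intro i _
    simp [hz i]
  have hmain := one_lt_multiplier_of_pos (P := p + p) (by omega) hfin hzp2
    (by rw [hsq]; positivity) (hbd m)
    (by
      obtain ⟨k, hk⟩ : ∃ k, p + p = k + 1 := ⟨p + p - 1, by omega⟩
      rw [hk, Function.iterate_succ_apply, hfq', hitq]) (hitq _)
  rw [hsq, one_lt_sq_iff_one_lt_abs, Finset.abs_prod] at hmain
  rw [Finset.prod_Ico_eq_prod_range, Nat.add_sub_cancel_left]
  refine hmain.trans_eq (Finset.prod_congr rfl fun i _ => ?_)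
  rw [hzdef, ← Function.iterate_add_apply, abs_neg, abs_mul, abs_two, add_comm]

/-- Exponential growth of the derivative along the critical orbit. -/
lemma exists_growth {a : ℝ} (ha : a ∈ Set.Ioo (1 : ℝ) 2) (hpre : StrictlyPreperiodic a) :
    ∃ c σ : ℝ, 0 < c ∧ 1 < σ ∧ ∀ j k : ℕ, j ≤ k →
      c * σ ^ (k - j) ≤ ∏ i ∈ Finset.Ico j k, 2 * |(qm a)^[i + 1] 0| := by
  obtain ⟨m, p, hm, hp, h⟩ := hpre.2
  have hlam := one_lt_prod_of_preperiodic ha hpre hm hp h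
  set w : ℕ → ℝ := fun i => 2 * |(qm a)^[i + 1] 0| with hw
  have hwpos : ∀ i, 0 < w i := fun i => by
    have := abs_pos.2 (hpre.1 (i + 1) (by omega))
    simp only [hw]; positivity
  have hwper : ∀ i, m ≤ i + 1 → w (i + p) = w i := by
    intro i hi
    obtain ⟨k, hk⟩ := Nat.exists_eq_add_of_le' hi
    simp only [hw]
    rw [show i + p + 1 = k + (m + p) by omega, hk, Function.iterate_add_apply, h,
      ← Function.iterate_add_apply]
  set l := ∏ i ∈ Finset.Ico m (m + p), 2 * |(qm a)^[i] 0|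
  have hl : ∏ i ∈ Finset.Ico (m - 1) (m - 1 + p), w i = l := by
    rw [Finset.prod_Ico_eq_prod_range]
    simp only [l]
    rw [Finset.prod_Ico_eq_prod_range]
    rw [Nat.add_sub_cancel_left, Nat.add_sub_cancel_left]
    apply Finset.prod_congr rfl
    intro i _
    simp only [hw]
    rw [show m - 1 + i + 1 = m + i by omega]
  set S : ℕ → ℝ := fun n => ∑ i ∈ Finset.range n, (Real.log (w i) - Real.log l / p) with hS
  have hSper : ∀ n, m - 1 ≤ n → S (n + p) = S n := by
    intro n hn
    induction n, hn using Nat.le_induction with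
    | base =>
      simp only [hS]
      rw [← Finset.sum_range_add_sum_Ico _ (Nat.le_add_right (m - 1) p)]
      simp only [Finset.sum_sub_distrib]
      rw [← Real.log_prod (fun i _ => (hwpos i).ne'), ← Real.log_prod (fun i _ => (hwpos i).ne'),
        hl]
      simp only [Finset.sum_const, Nat.card_Ico, nsmul_eq_mul, Nat.add_sub_cancel_left]
      have : (p : ℝ) ≠ 0 := by positivity
      field_simp
      ring
    | succ n hn ih =>
      have e1 : S (n + 1 + p) = S (n + p) + (Real.log (w (n + p)) - Real.log l / p) := by
        rw [show n + 1 + p = n + p + 1 by omega]; simp only [hS]; rw [Finset.sum_range_succ]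
      have e2 : S (n + 1) = S n + (Real.log (w n) - Real.log l / p) := by
        simp only [hS]; rw [Finset.sum_range_succ]
      rw [e1, e2, ih, hwper n (by omega)]
  obtain ⟨B, hB⟩ : ∃ B, ∀ n, |S n| ≤ B := by
    refine ⟨∑ i ∈ Finset.range (m + p), |S i|, fun n => ?_⟩
    induction n using Nat.strong_induction_on with
    | _ n ih =>
      by_cases hn : n < m + p
      · exact Finset.single_le_sum (f := fun i => |S i|) (fun i _ => abs_nonneg _)
          (Finset.mem_range.2 hn)
      · have := hSper (n - p) (by omega)
        rw [Nat.sub_add_cancel (by omega)] at this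
        rw [this]
        exact ih (n - p) (by omega)
  have hlp : 0 < Real.log l / p := by
    have := Real.log_pos hlam
    positivity
  refine ⟨Real.exp (-2 * B), Real.exp (Real.log l / p), Real.exp_pos _,
    Real.one_lt_exp_iff.2 hlp, fun j k hjk => ?_⟩
  have e : ∏ i ∈ Finset.Ico j k, w i =
      Real.exp (S k - S j + (k - j : ℕ) * (Real.log l / p)) := by
    simp only [hS]
    rw [← Finset.sum_Ico_eq_sub _ hjk, Finset.sum_sub_distrib]
    simp only [Finset.sum_const, Nat.card_Ico, nsmul_eq_mul, sub_add_cancel]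
    rw [Real.exp_sum]
    exact Finset.prod_congr rfl fun i _ => (Real.exp_log (hwpos i)).symm
  rw [e, ← Real.exp_nat_mul, ← Real.exp_add]
  apply Real.exp_le_exp.2
  have := abs_le.1 (hB k)
  have := abs_le.1 (hB j)
  linarith

lemma sum_geometric_le {r : ℝ} (h0 : 0 ≤ r) (h1 : r < 1) (n : ℕ) :
    ∑ i ∈ Finset.range n, r ^ i ≤ (1 - r)⁻¹ := by
  rw [← tsum_geometric_of_lt_one h0 h1]
  exact (summable_geometric_of_lt_one h0 h1).sum_le_tsum _ fun i _ => pow_nonneg h0 i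

lemma one_sub_sum_le_prod {ι : Type*} [DecidableEq ι] (s : Finset ι) (f : ι → ℝ)
    (h0 : ∀ i ∈ s, 0 ≤ f i) (h1 : ∀ i ∈ s, f i ≤ 1) :
    1 - ∑ i ∈ s, f i ≤ ∏ i ∈ s, (1 - f i) := by
  induction s using Finset.induction_on with
  | empty => simp
  | insert i s hi ih =>
    rw [Finset.sum_insert hi, Finset.prod_insert hi]
    have ih' := ih (fun j hj => h0 j (Finset.mem_insert_of_mem hj))
      (fun j hj => h1 j (Finset.mem_insert_of_mem hj))
    have a0 := h0 i (Finset.mem_insert_self i s)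
    have a1 := h1 i (Finset.mem_insert_self i s)
    have hs : 0 ≤ ∑ j ∈ s, f j :=
      Finset.sum_nonneg fun j hj => h0 j (Finset.mem_insert_of_mem hj)
    nlinarith

/-- The shadowing interval `I_{n+1}`. -/
def shadow (a α : ℝ) (n : ℕ) : Set ℝ := Set.Icc (IEnd a α n).1 (IEnd a α n).2

lemma isCompact_image_shadow (a α : ℝ) (n : ℕ) : IsCompact (qm a '' shadow a α n) := by
  apply isCompact_Icc.image
  unfold qm
  fun_prop

lemma mem_shadow_succ {a α x e : ℝ} {n : ℕ} (hx : x ∈ shadow a α n) (he : |e| ≤ α) :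
    qm a x + e ∈ shadow a α (n + 1) := by
  have hc := isCompact_image_shadow a α n
  have he' := abs_le.1 he
  have h1 := csInf_le hc.bddBelow (Set.mem_image_of_mem (qm a) hx)
  have h2 := le_csSup hc.bddAbove (Set.mem_image_of_mem (qm a) hx)
  simp only [shadow, IEnd, Set.mem_Icc] at h1 h2 ⊢
  constructor <;> linarith

lemma critical_mem_shadow {a α : ℝ} (hα : 0 < α) (n : ℕ) :
    (qm a)^[n + 1] 0 ∈ shadow a α n := by
  induction n with
  | zero => simp [shadow, IEnd]; linarith
  | succ n ih =>
    rw [Function.iterate_succ_apply']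
    have := mem_shadow_succ ih (e := 0) (by simpa using hα.le)
    simpa using this

lemma two_mul_le_len {a α : ℝ} (hα : 0 < α) (n : ℕ) : 2 * α ≤ len a α n := by
  cases n with
  | zero => simp [len, IEnd]; linarith
  | succ n =>
    have hc := isCompact_image_shadow a α n
    have hm := Set.mem_image_of_mem (qm a) (critical_mem_shadow (a := a) hα n)
    have h1 := csInf_le hc.bddBelow hm
    have h2 := le_csSup hc.bddAbove hm
    simp only [len, IEnd]
    simp only [shadow] at h1 h2
    linarith

lemma abs_sub_le_len {a α x y : ℝ} {n : ℕ} (hx : x ∈ shadow a α n) (hy : y ∈ shadow a α n) :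
    |x - y| ≤ len a α n := by
  simp only [shadow, Set.mem_Icc] at hx hy
  rw [abs_le, len]
  constructor <;> linarith

lemma abs_add_le_of_mem_shadow {a α x y : ℝ} {n : ℕ} (hα : 0 < α)
    (hx : x ∈ shadow a α n) (hy : y ∈ shadow a α n) :
    |x + y| ≤ 2 * |(qm a)^[n + 1] 0| + 2 * len a α n := by
  have h1 := abs_sub_le_len hx (critical_mem_shadow hα n)
  have h2 := abs_sub_le_len hy (critical_mem_shadow hα n)
  have h3 : x + y = 2 * (qm a)^[n + 1] 0 + ((x - (qm a)^[n + 1] 0) + (y - (qm a)^[n + 1] 0)) := by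
    ring
  have h4 : |2 * (qm a)^[n + 1] 0| = 2 * |(qm a)^[n + 1] 0| := by rw [abs_mul, abs_two]
  rw [h3]
  have := abs_add_le (2 * (qm a)^[n + 1] 0) ((x - (qm a)^[n + 1] 0) + (y - (qm a)^[n + 1] 0))
  have := abs_add_le (x - (qm a)^[n + 1] 0) (y - (qm a)^[n + 1] 0)
  linarith

lemma le_abs_add_of_mem_shadow {a α x y : ℝ} {n : ℕ} (hα : 0 < α)
    (hx : x ∈ shadow a α n) (hy : y ∈ shadow a α n) :
    2 * |(qm a)^[n + 1] 0| - 2 * len a α n ≤ |x + y| := by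
  have h1 := abs_sub_le_len hx (critical_mem_shadow hα n)
  have h2 := abs_sub_le_len hy (critical_mem_shadow hα n)
  have h3 : 2 * (qm a)^[n + 1] 0 = x + y - ((x - (qm a)^[n + 1] 0) + (y - (qm a)^[n + 1] 0)) := by
    ring
  have h4 : |2 * (qm a)^[n + 1] 0| = 2 * |(qm a)^[n + 1] 0| := by rw [abs_mul, abs_two]
  rw [← h4, h3]
  have := abs_sub (x + y) ((x - (qm a)^[n + 1] 0) + (y - (qm a)^[n + 1] 0))
  have := abs_add_le (x - (qm a)^[n + 1] 0) (y - (qm a)^[n + 1] 0)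
  linarith

lemma len_succ_le {a α : ℝ} (hα : 0 < α) (n : ℕ) :
    len a α (n + 1) ≤ len a α n * (2 * |(qm a)^[n + 1] 0| + 2 * len a α n) + 2 * α := by
  have hc := isCompact_image_shadow a α n
  have hne : (qm a '' shadow a α n).Nonempty := ⟨_, _, critical_mem_shadow hα n, rfl⟩
  obtain ⟨x, hx, hx'⟩ := hc.sSup_mem hne
  obtain ⟨y, hy, hy'⟩ := hc.sInf_mem hne
  have e : len a α (n + 1) = qm a x - qm a y + 2 * α := by
    rw [hx', hy']; simp only [len, IEnd, shadow]; ring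
  have h1 := abs_sub_le_len hx hy
  have h2 := abs_add_le_of_mem_shadow hα hx hy
  have h3 : qm a x - qm a y ≤ |x - y| * |x + y| := by
    rw [← abs_mul, qm, qm]
    refine le_trans (le_of_eq ?_) (neg_abs_le _ |> neg_le.1)
    ring
  have := mul_le_mul h1 h2 (abs_nonneg _) ((abs_nonneg _).trans h1)
  linarith

lemma le_len_succ {a α : ℝ} (hα : 0 < α) (n : ℕ) :
    len a α n * (2 * |(qm a)^[n + 1] 0| - 2 * len a α n) ≤ len a α (n + 1) := by
  have hc := isCompact_image_shadow a α n
  have hlen := two_mul_le_len (a := a) hα n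
  have hl : (IEnd a α n).1 ∈ shadow a α n := by
    simp only [len] at hlen; simp only [shadow, Set.mem_Icc]; constructor <;> linarith
  have hr : (IEnd a α n).2 ∈ shadow a α n := by
    simp only [len] at hlen; simp only [shadow, Set.mem_Icc]; constructor <;> linarith
  have h0 := le_abs_add_of_mem_shadow hα hl hr
  have h1 := csInf_le hc.bddBelow (Set.mem_image_of_mem (qm a) hl)
  have h2 := le_csSup hc.bddAbove (Set.mem_image_of_mem (qm a) hl)
  have h3 := csInf_le hc.bddBelow (Set.mem_image_of_mem (qm a) hr)
  have h4 := le_csSup hc.bddAbove (Set.mem_image_of_mem (qm a) hr)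
  have e : len a α (n + 1) =
      sSup (qm a '' shadow a α n) - sInf (qm a '' shadow a α n) + 2 * α := by
    simp only [len, IEnd, shadow]; ring
  have h5 : |qm a (IEnd a α n).1 - qm a (IEnd a α n).2| ≤ len a α (n + 1) := by
    rw [abs_le]; constructor <;> linarith
  have h6 : |qm a (IEnd a α n).1 - qm a (IEnd a α n).2| =
      len a α n * |(IEnd a α n).1 + (IEnd a α n).2| := by
    rw [qm, qm, show a - (IEnd a α n).1 ^ 2 - (a - (IEnd a α n).2 ^ 2) =
      len a α n * ((IEnd a α n).1 + (IEnd a α n).2) by simp only [len]; ring, abs_mul,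
      abs_of_nonneg (by linarith : 0 ≤ len a α n)]
  rw [h6] at h5
  exact (mul_le_mul_of_nonneg_left h0 (by linarith)).trans h5

/-- The defining properties of `N(α)`. -/
lemma Nal_spec {a ξ₀ α : ℝ} (hξ₀ : 0 < ξ₀) (hα : 0 < α) :
    (∀ n < Nal a ξ₀ α, len a α n < ξ₀) ∧ ∑ n ∈ Finset.range (Nal a ξ₀ α), len a α n ≤ ξ₀ ∧
      ξ₀ ≤ ∑ n ∈ Finset.range (Nal a ξ₀ α + 1), len a α n := by
  set S := {N : ℕ | (∀ n : ℕ, 1 ≤ n → n ≤ N → len a α (n - 1) < ξ₀) ∧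
    ∑ n ∈ Finset.range N, len a α n ≤ ξ₀} with hS
  have hne : S.Nonempty := ⟨0, by intro n h1 h2; omega, by simpa using hξ₀.le⟩
  have hbd : BddAbove S := by
    refine ⟨⌈ξ₀ / (2 * α)⌉₊, fun N hN => ?_⟩
    have h1 : N • (2 * α) ≤ ∑ n ∈ Finset.range N, len a α n := by
      have := Finset.card_nsmul_le_sum (Finset.range N) (fun n => len a α n) (2 * α)
        fun n _ => two_mul_le_len hα n
      simpa using this
    have h2 : (N : ℝ) ≤ ξ₀ / (2 * α) := by
      rw [le_div_iff₀ (by positivity)]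
      simpa using h1.trans hN.2
    exact_mod_cast h2.trans (Nat.le_ceil _)
  have hmem : Nal a ξ₀ α ∈ S := Nat.sSup_mem hne hbd
  refine ⟨fun n hn => hmem.1 (n + 1) (by omega) (by omega), hmem.2, ?_⟩
  by_contra! hlt
  have : Nal a ξ₀ α + 1 ∈ S := by
    refine ⟨fun n h1 h2 => ?_, hlt.le⟩
    refine lt_of_le_of_lt ?_ hlt
    exact Finset.single_le_sum (f := fun n => len a α n)
      (fun i _ => (by positivity : 0 ≤ 2 * α).trans (two_mul_le_len hα i))
      (Finset.mem_range.2 (by omega))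
  have := le_csSup hbd this
  have : Nal a ξ₀ α + 1 ≤ Nal a ξ₀ α := this
  omega

lemma four_mul_le_of_avoid {a ξ₀ : ℝ}
    (hcrit : ∀ i : ℕ, 1 ≤ i → (qm a)^[i] 0 ∉ Set.Ioo (-(2 * ξ₀)) (2 * ξ₀)) (n : ℕ) :
    4 * ξ₀ ≤ 2 * |(qm a)^[n + 1] 0| := by
  have := hcrit (n + 1) (by omega)
  rw [Set.mem_Ioo, ← abs_lt, not_lt] at this
  linarith

lemma sum_len_Ico_le {a ξ₀ α : ℝ} (hξ₀ : 0 < ξ₀) (hα : 0 < α) {j k : ℕ}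
    (hk : k ≤ Nal a ξ₀ α) : ∑ n ∈ Finset.Ico j k, len a α n ≤ ξ₀ := by
  refine le_trans (Finset.sum_le_sum_of_subset_of_nonneg ?_ ?_) (Nal_spec (a := a) hξ₀ hα).2.1
  · intro n hn
    simp only [Finset.mem_Ico, Finset.mem_range] at hn ⊢
    omega
  · exact fun i _ _ => (by positivity : 0 ≤ 2 * α).trans (two_mul_le_len hα i)

/-- Bounded distortion up to time `N(α)`, lower bound. -/
lemma half_prod_le_prod {a ξ₀ α : ℝ} (hξ₀ : 0 < ξ₀) (hα : 0 < α)
    (hcrit : ∀ i : ℕ, 1 ≤ i → (qm a)^[i] 0 ∉ Set.Ioo (-(2 * ξ₀)) (2 * ξ₀))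
    {j k : ℕ} (hk : k ≤ Nal a ξ₀ α) {s : ℕ → ℝ}
    (hs : ∀ n < Nal a ξ₀ α, 2 * |(qm a)^[n + 1] 0| - 2 * len a α n ≤ s n) :
    (∏ i ∈ Finset.Ico j k, 2 * |(qm a)^[i + 1] 0|) / 2 ≤ ∏ i ∈ Finset.Ico j k, s i := by
  have hlen : ∀ n, 0 ≤ len a α n := fun n =>
    (by positivity : 0 ≤ 2 * α).trans (two_mul_le_len hα n)
  have h1 : ∏ i ∈ Finset.Ico j k, (2 * |(qm a)^[i + 1] 0|) * (1 - len a α i / (2 * ξ₀)) ≤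
      ∏ i ∈ Finset.Ico j k, s i := by
    apply Finset.prod_le_prod
    · intro i hi
      have : i < Nal a ξ₀ α := (Finset.mem_Ico.1 hi).2.trans_le hk
      have := (Nal_spec (a := a) hξ₀ hα).1 i this
      have : len a α i / (2 * ξ₀) ≤ 1 := by
        rw [div_le_one (by positivity)]; linarith
      have : 0 ≤ 1 - len a α i / (2 * ξ₀) := by linarith
      positivity
    · intro i hi
      refine le_trans ?_ (hs i ((Finset.mem_Ico.1 hi).2.trans_le hk))
      have h4 := four_mul_le_of_avoid hcrit i
      have : 2 * len a α i ≤ 2 * |(qm a)^[i + 1] 0| * (len a α i / (2 * ξ₀)) := by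
        rw [mul_div_assoc', le_div_iff₀ (by positivity)]
        nlinarith [hlen i]
      linarith
  rw [Finset.prod_mul_distrib] at h1
  have h2 := one_sub_sum_le_prod (Finset.Ico j k) (fun i => len a α i / (2 * ξ₀))
    (fun i _ => div_nonneg (hlen i) (by positivity))
    (fun i hi => by
      have : i < Nal a ξ₀ α := (Finset.mem_Ico.1 hi).2.trans_le hk
      have := (Nal_spec (a := a) hξ₀ hα).1 i this
      rw [div_le_one (by positivity)]; linarith)
  rw [← Finset.sum_div] at h2
  have h3 : (∑ n ∈ Finset.Ico j k, len a α n) / (2 * ξ₀) ≤ 1 / 2 := by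
    rw [div_le_iff₀ (by positivity)]
    have := sum_len_Ico_le (a := a) hξ₀ hα (j := j) hk
    linarith
  have h5 : 0 ≤ ∏ i ∈ Finset.Ico j k, 2 * |(qm a)^[i + 1] 0| :=
    Finset.prod_nonneg fun i _ => by positivity
  refine le_trans ?_ h1
  rw [div_eq_mul_inv]
  exact mul_le_mul_of_nonneg_left (by norm_num at *; linarith) h5

/-- The parameter and the derivative at time `N(α)` are comparable. -/
lemma exists_le_mul_prod_at_Nal {a ξ₀ c σ : ℝ} (hξ₀ : 0 < ξ₀)
    (hcrit : ∀ i : ℕ, 1 ≤ i → (qm a)^[i] 0 ∉ Set.Ioo (-(2 * ξ₀)) (2 * ξ₀))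
    (hc : 0 < c) (hσ : 1 < σ)
    (hgrow : ∀ j k : ℕ, j ≤ k →
      c * σ ^ (k - j) ≤ ∏ i ∈ Finset.Ico j k, 2 * |(qm a)^[i + 1] 0|) :
    ∃ K > 0, ∀ α : ℝ, 0 < α →
      ξ₀ ≤ K * (α * ∏ i ∈ Finset.Ico 0 (Nal a ξ₀ α), 2 * |(qm a)^[i + 1] 0|) := by
  set r := σ⁻¹ with hr
  have hr0 : 0 ≤ r := by rw [hr]; positivity
  have hr1 : r < 1 := inv_lt_one_of_one_lt₀ hσ
  set G := (1 - r)⁻¹ with hG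
  have hGpos : 0 < G := by rw [hG]; have : 0 < 1 - r := by linarith
                           positivity
  refine ⟨Real.exp 1 * (4 + 2 * (G / c)) * (G / c), by positivity, fun α hα => ?_⟩
  set w : ℕ → ℝ := fun i => 2 * |(qm a)^[i + 1] 0| with hw
  have hw4 : ∀ i, 4 * ξ₀ ≤ w i := four_mul_le_of_avoid hcrit
  have hwpos : ∀ i, 0 < w i := fun i => by have := hw4 i; linarith
  set P : ℕ → ℝ := fun n => ∏ i ∈ Finset.Ico 0 n, w i with hP
  have hPpos : ∀ n, 0 < P n := fun n => Finset.prod_pos fun i _ => hwpos i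
  set E : ℕ → ℝ := fun n => ∏ i ∈ Finset.Ico 0 n, (1 + 2 * len a α i / w i) with hE
  have hlen : ∀ n, 0 ≤ len a α n := fun n =>
    (by positivity : 0 ≤ 2 * α).trans (two_mul_le_len hα n)
  have hE1 : ∀ n, 1 ≤ E n := fun n => by
    simp only [hE]
    refine Finset.prod_induction _ (fun x => (1 : ℝ) ≤ x) (fun _ _ => one_le_mul_of_one_le_of_one_le)
      le_rfl fun i _ => ?_
    have : 0 ≤ 2 * len a α i / w i := div_nonneg (mul_nonneg zero_le_two (hlen i)) (hwpos i).le
    linarith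
  have hEexp : ∀ n ≤ Nal a ξ₀ α, E n ≤ Real.exp 1 := fun n hn => by
    have h1 : E n ≤ ∏ i ∈ Finset.Ico 0 n, Real.exp (len a α i / ξ₀) := by
      apply Finset.prod_le_prod
      · intro i _
        have : 0 ≤ 2 * len a α i / w i := div_nonneg (mul_nonneg zero_le_two (hlen i)) (hwpos i).le
        linarith
      · intro i _
        have h2 : 2 * len a α i / w i ≤ len a α i / ξ₀ := by
          rw [div_le_div_iff₀ (hwpos i) hξ₀]
          nlinarith [hlen i, hw4 i]
        have := Real.add_one_le_exp (len a α i / ξ₀)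
        linarith
    refine h1.trans ?_
    rw [← Real.exp_sum, ← Finset.sum_div]
    apply Real.exp_le_exp.2
    rw [div_le_one hξ₀]
    exact sum_len_Ico_le hξ₀ hα hn
  have hlenbd : ∀ n, len a α n ≤
      E n * P n * (α * (4 + 2 * ∑ i ∈ Finset.range n, (P (i + 1))⁻¹)) := by
    intro n
    induction n with
    | zero => simp [hE, hP, len, IEnd]; linarith
    | succ n ih =>
      have hP1 : P (n + 1) = P n * w n := by
        simp only [hP]; rw [Finset.prod_Ico_succ_top (Nat.zero_le n)]
      have hE2 : E (n + 1) = E n * (1 + 2 * len a α n / w n) := by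
        simp only [hE]; rw [Finset.prod_Ico_succ_top (Nat.zero_le n)]
      have h1 := len_succ_le (a := a) hα n
      have h2 : len a α n * (w n + 2 * len a α n) =
          len a α n * (w n * (1 + 2 * len a α n / w n)) := by
        have := (hwpos n).ne'
        field_simp
      have h3 : 0 ≤ w n * (1 + 2 * len a α n / w n) := by
        have := hwpos n; have := hlen n; positivity
      have h4 := mul_le_mul_of_nonneg_right ih h3
      have h5 : 2 * α ≤ E (n + 1) * P (n + 1) * (α * (2 * (P (n + 1))⁻¹)) := by
        have h6 : E (n + 1) * P (n + 1) * (α * (2 * (P (n + 1))⁻¹)) = E (n + 1) * (2 * α) := by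
          have := (hPpos (n + 1)).ne'
          field_simp
        rw [h6]
        exact le_mul_of_one_le_left (by positivity) (hE1 _)
      rw [Finset.sum_range_succ]
      rw [h2] at h1
      refine h1.trans ((add_le_add h4 h5).trans (le_of_eq ?_))
      rw [hP1, hE2]
      ring
  have hgrow' : ∀ n, (P n)⁻¹ ≤ c⁻¹ * r ^ n := fun n => by
    have := hgrow 0 n (Nat.zero_le n)
    rw [Nat.sub_zero] at this
    rw [hr, inv_pow, ← mul_inv]
    exact inv_anti₀ (by positivity) this
  have hsum1 : ∀ n, ∑ i ∈ Finset.range n, (P (i + 1))⁻¹ ≤ G / c := fun n => by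
    calc ∑ i ∈ Finset.range n, (P (i + 1))⁻¹ ≤ ∑ i ∈ Finset.range n, c⁻¹ * r ^ i := by
          apply Finset.sum_le_sum
          intro i _
          refine (hgrow' (i + 1)).trans (mul_le_mul_of_nonneg_left ?_ (by positivity))
          exact pow_le_pow_of_le_one hr0 hr1.le (Nat.le_succ i)
      _ ≤ G / c := by
          rw [← Finset.mul_sum, div_eq_inv_mul]
          exact mul_le_mul_of_nonneg_left (sum_geometric_le hr0 hr1 n) (by positivity)
  set N := Nal a ξ₀ α
  have hPN : ∀ n ≤ N, P n ≤ P N * (c⁻¹ * r ^ (N - n)) := fun n hn => by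
    have h1 : P N = P n * ∏ i ∈ Finset.Ico n N, w i :=
      (Finset.prod_Ico_consecutive _ (Nat.zero_le n) hn).symm
    have h2 := hgrow n N hn
    have h3 : c⁻¹ * r ^ (N - n) = (c * σ ^ (N - n))⁻¹ := by rw [hr, inv_pow, mul_inv]
    rw [h1, h3, mul_assoc]
    apply le_mul_of_one_le_right (hPpos n).le
    rw [← div_eq_mul_inv, one_le_div (by positivity)]
    exact h2
  have hsum2 : ∑ n ∈ Finset.range (N + 1), P n ≤ P N * (G / c) := by
    calc ∑ n ∈ Finset.range (N + 1), P n
        ≤ ∑ n ∈ Finset.range (N + 1), P N * (c⁻¹ * r ^ (N - n)) :=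
          Finset.sum_le_sum fun n hn => hPN n (Nat.lt_succ_iff.1 (Finset.mem_range.1 hn))
      _ = P N * (c⁻¹ * ∑ n ∈ Finset.range (N + 1), r ^ n) := by
          rw [← Finset.mul_sum, ← Finset.mul_sum,
            ← Finset.sum_range_reflect (fun n => r ^ n) (N + 1)]
          simp
      _ ≤ P N * (G / c) := by
          rw [div_eq_inv_mul]
          exact mul_le_mul_of_nonneg_left
            (mul_le_mul_of_nonneg_left (sum_geometric_le hr0 hr1 _) (by positivity)) (hPpos N).le
  calc ξ₀ ≤ ∑ n ∈ Finset.range (N + 1), len a α n := (Nal_spec hξ₀ hα).2.2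
    _ ≤ ∑ n ∈ Finset.range (N + 1), Real.exp 1 * (α * (4 + 2 * (G / c))) * P n := by
        apply Finset.sum_le_sum
        intro n hn
        refine (hlenbd n).trans ?_
        have h1 := hEexp n (Nat.lt_succ_iff.1 (Finset.mem_range.1 hn))
        have h2 : 4 + 2 * ∑ i ∈ Finset.range n, (P (i + 1))⁻¹ ≤ 4 + 2 * (G / c) := by
          have := hsum1 n; linarith
        have h3 : 0 ≤ ∑ i ∈ Finset.range n, (P (i + 1))⁻¹ :=
          Finset.sum_nonneg fun i _ => (inv_pos.2 (hPpos _)).le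
        have h0 := (hPpos n).le
        have : E n * P n * (α * (4 + 2 * ∑ i ∈ Finset.range n, (P (i + 1))⁻¹)) ≤
            Real.exp 1 * P n * (α * (4 + 2 * (G / c))) := by gcongr
        linarith
    _ = Real.exp 1 * (α * (4 + 2 * (G / c))) * ∑ n ∈ Finset.range (N + 1), P n := by
        rw [Finset.mul_sum]
    _ ≤ Real.exp 1 * (α * (4 + 2 * (G / c))) * (P N * (G / c)) := by gcongr
    _ = _ := by ring

/-- An upper bound for `N(α)`. -/
lemma exists_Nal_bound {a ξ₀ c σ : ℝ} (hξ₀ : 0 < ξ₀)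
    (hcrit : ∀ i : ℕ, 1 ≤ i → (qm a)^[i] 0 ∉ Set.Ioo (-(2 * ξ₀)) (2 * ξ₀))
    (hc : 0 < c) (hσ : 1 < σ)
    (hgrow : ∀ j k : ℕ, j ≤ k →
      c * σ ^ (k - j) ≤ ∏ i ∈ Finset.Ico j k, 2 * |(qm a)^[i + 1] 0|) :
    ∃ K > 0, ∀ α : ℝ, 0 < α → α ≤ 1 → α * (Nal a ξ₀ α : ℝ) ^ 2 ≤ K := by
  obtain ⟨K₀, hK₀⟩ : ∃ K₀ : ℝ, ∀ n : ℕ, ((n : ℝ) + 1) ^ 2 ≤ K₀ * σ ^ n := by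
    have h1 := tendsto_pow_const_div_const_pow_of_one_lt 2 hσ
    have h2 := (h1.comp (tendsto_add_atTop_nat 1)).bddAbove_range
    obtain ⟨K, hK⟩ := h2
    refine ⟨K * σ, fun n => ?_⟩
    have := hK ⟨n, rfl⟩
    simp only [Function.comp] at this
    rw [div_le_iff₀ (by positivity)] at this
    push_cast at this
    rw [pow_succ σ n] at this
    linarith
  have hK₀pos : 0 < K₀ := by
    have := hK₀ 0
    norm_num at this; linarith
  refine ⟨K₀ * ξ₀ / c + 1, by positivity, fun α hα hα1 => ?_⟩
  rcases (Nal a ξ₀ α).eq_zero_or_eq_succ_pred with hN | hN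
  · rw [hN]; simp; positivity
  · have hlen : ∀ n, 0 ≤ len a α n := fun n =>
      (by positivity : 0 ≤ 2 * α).trans (two_mul_le_len hα n)
    set s : ℕ → ℝ := fun n => 2 * |(qm a)^[n + 1] 0| - 2 * len a α n with hs
    have hspos : ∀ i < Nal a ξ₀ α, 0 ≤ s i := fun i hi => by
      have h1 := (Nal_spec (a := a) hξ₀ hα).1 i hi
      have h2 := four_mul_le_of_avoid hcrit i
      simp only [hs]
      linarith
    have h1 : ∀ k ≤ Nal a ξ₀ α, (∏ i ∈ Finset.Ico 0 k, s i) * (4 * α) ≤ len a α k := by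
      intro k hk
      induction k with
      | zero => simp [len, IEnd]; linarith
      | succ k ih =>
        rw [Finset.prod_Ico_succ_top (Nat.zero_le k)]
        have := ih (by omega)
        have h3 := le_len_succ (a := a) hα k
        have := mul_le_mul_of_nonneg_right this (hspos k (by omega))
        simp only [hs] at this h3 ⊢
        linarith
    set p := (Nal a ξ₀ α).pred
    have hp : p < Nal a ξ₀ α := by omega
    have h2 := h1 p hp.le
    have h3 := half_prod_le_prod hξ₀ hα hcrit (j := 0) hp.le (s := s) fun n _ => le_rfl
    have h4 := hgrow 0 p (Nat.zero_le p)
    have h5 := (Nal_spec (a := a) hξ₀ hα).1 p hp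
    rw [Nat.sub_zero] at h4
    have h6 : c * σ ^ p / 2 * (4 * α) < ξ₀ := by
      have : c * σ ^ p / 2 * (4 * α) ≤ (∏ i ∈ Finset.Ico 0 p, s i) * (4 * α) := by gcongr; linarith
      linarith
    have h7 : σ ^ p * α ≤ ξ₀ / c := by
      rw [le_div_iff₀ hc]
      have : 0 < σ ^ p := by positivity
      nlinarith [mul_pos (mul_pos hc this) hα]
    rw [hN, Nat.succ_eq_add_one]
    push_cast
    calc α * ((p : ℝ) + 1) ^ 2 ≤ α * (K₀ * σ ^ p) := by gcongr; exact hK₀ p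
      _ = K₀ * (σ ^ p * α) := by ring
      _ ≤ K₀ * (ξ₀ / c) := by gcongr
      _ ≤ K₀ * ξ₀ / c + 1 := by rw [mul_div_assoc]; linarith

lemma exists_sum_sub_le {a ξ₀ c σ : ℝ} (hξ₀ : 0 < ξ₀)
    (hcrit : ∀ i : ℕ, 1 ≤ i → (qm a)^[i] 0 ∉ Set.Ioo (-(2 * ξ₀)) (2 * ξ₀))
    (hc : 0 < c) (hσ : 1 < σ)
    (hgrow : ∀ j k : ℕ, j ≤ k →
      c * σ ^ (k - j) ≤ ∏ i ∈ Finset.Ico j k, 2 * |(qm a)^[i + 1] 0|) :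
    ∃ C > 0, ∀ α : ℝ, 0 < α → ∀ x y : ℕ → ℝ,
      (∀ n < Nal a ξ₀ α, x n ∈ shadow a α n) → (∀ n < Nal a ξ₀ α, y n ∈ shadow a α n) →
      (∀ n < Nal a ξ₀ α, |x n - y n| * |x n + y n| ≤ |x (n + 1) - y (n + 1)| + 2 * α) →
      ∑ n ∈ Finset.range (Nal a ξ₀ α), |x n - y n| ≤
        C * (|x (Nal a ξ₀ α) - y (Nal a ξ₀ α)| + α * Nal a ξ₀ α) := by
  set r := σ⁻¹ with hr
  have hr0 : 0 ≤ r := by rw [hr]; positivity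
  have hr1 : r < 1 := inv_lt_one_of_one_lt₀ hσ
  set G := (1 - r)⁻¹ with hG
  have hGpos : 0 < G := by rw [hG]; have : 0 < 1 - r := by linarith
                           positivity
  refine ⟨4 / c * G, by positivity, fun α hα x y hx hy hxy => ?_⟩
  set N := Nal a ξ₀ α with hN
  set s : ℕ → ℝ := fun n => |x n + y n| with hs
  set δ : ℕ → ℝ := fun n => |x n - y n| with hδ
  have hprod : ∀ j k, j ≤ k → k ≤ N → c / 2 * σ ^ (k - j) ≤ ∏ i ∈ Finset.Ico j k, s i := by
    intro j k hjk hk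
    have h1 := half_prod_le_prod hξ₀ hα hcrit (j := j) hk (s := s)
      fun n hn => le_abs_add_of_mem_shadow hα (hx n hn) (hy n hn)
    have h2 := hgrow j k hjk
    linarith
  have hprodinv : ∀ j k, j ≤ k → k ≤ N → (∏ i ∈ Finset.Ico j k, s i)⁻¹ ≤ 2 / c * r ^ (k - j) := by
    intro j k hjk hk
    have h3 : 2 / c * r ^ (k - j) = (c / 2 * σ ^ (k - j))⁻¹ := by
      rw [hr, inv_pow, mul_inv, inv_div]
    rw [h3]
    exact inv_anti₀ (by positivity) (hprod j k hjk hk)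
  have hprodpos : ∀ j k, j ≤ k → k ≤ N → 0 < ∏ i ∈ Finset.Ico j k, s i := fun j k hjk hk =>
    (by positivity : 0 < c / 2 * σ ^ (k - j)).trans_le (hprod j k hjk hk)
  have htel : ∀ j k, j ≤ k → k ≤ N → δ j * ∏ i ∈ Finset.Ico j k, s i ≤
      δ k + 2 * α * ∑ i ∈ Finset.Ico j k, ∏ l ∈ Finset.Ico (i + 1) k, s l := by
    intro j k hjk
    induction k, hjk using Nat.le_induction with
    | base => intro _; simp
    | succ k hjk ih =>
      intro hk
      have h1 := mul_le_mul_of_nonneg_right (ih (by omega)) (abs_nonneg (x k + y k))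
      have h2 := hxy k (by omega)
      rw [Finset.prod_Ico_succ_top hjk, Finset.sum_Ico_succ_top hjk]
      have h3 : ∑ i ∈ Finset.Ico j k, ∏ l ∈ Finset.Ico (i + 1) (k + 1), s l =
          (∑ i ∈ Finset.Ico j k, ∏ l ∈ Finset.Ico (i + 1) k, s l) * s k := by
        rw [Finset.sum_mul]
        apply Finset.sum_congr rfl
        intro i hi
        have := (Finset.mem_Ico.1 hi).2
        rw [Finset.prod_Ico_succ_top (by omega)]
      rw [h3, Finset.Ico_self, Finset.prod_empty]
      simp only [hδ, hs] at h1 h2 ⊢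
      linarith
  have hδj : ∀ j ∈ Finset.range N, δ j ≤ 2 / c * (r ^ (N - j) * δ N + 2 * α * G) := by
    intro j hj
    have hjN : j ≤ N := (Finset.mem_range.1 hj).le
    have h1 := htel j N hjN le_rfl
    have h0 := hprodpos j N hjN le_rfl
    rw [← le_div_iff₀ h0] at h1
    refine h1.trans ?_
    rw [add_div, div_eq_mul_inv, mul_div_assoc, Finset.sum_div]
    have h2 : δ N * (∏ i ∈ Finset.Ico j N, s i)⁻¹ ≤ δ N * (2 / c * r ^ (N - j)) :=
      mul_le_mul_of_nonneg_left (hprodinv j N hjN le_rfl) (abs_nonneg _)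
    have h3 : ∑ i ∈ Finset.Ico j N,
        (∏ l ∈ Finset.Ico (i + 1) N, s l) / ∏ i ∈ Finset.Ico j N, s i ≤ 2 / c * G := by
      calc _ ≤ ∑ i ∈ Finset.Ico j N, 2 / c * r ^ (i - j) := by
            apply Finset.sum_le_sum
            intro i hi
            obtain ⟨hi1, hi2⟩ := Finset.mem_Ico.1 hi
            have h4 := Finset.prod_Ico_consecutive s (show j ≤ i + 1 by omega)
              (show i + 1 ≤ N by omega)
            rw [← h4, mul_comm, div_mul_cancel_left₀ (hprodpos (i + 1) N (by omega) le_rfl).ne']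
            refine (hprodinv j (i + 1) (by omega) (by omega)).trans ?_
            apply mul_le_mul_of_nonneg_left _ (by positivity)
            exact pow_le_pow_of_le_one hr0 hr1.le (by omega)
        _ ≤ 2 / c * G := by
            rw [← Finset.mul_sum, Finset.sum_Ico_eq_sum_range]
            simp only [Nat.add_sub_cancel_left]
            exact mul_le_mul_of_nonneg_left (sum_geometric_le hr0 hr1 _) (by positivity)
    have h4 := mul_le_mul_of_nonneg_left h3 (by positivity : 0 ≤ 2 * α)
    linarith
  refine (Finset.sum_le_sum hδj).trans ?_
  rw [← Finset.mul_sum, Finset.sum_add_distrib, ← Finset.sum_mul]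
  have h5 : ∑ j ∈ Finset.range N, r ^ (N - j) ≤ G := by
    refine le_trans ?_ (sum_geometric_le hr0 hr1 N)
    rw [← Finset.sum_range_reflect (fun j => r ^ j) N]
    apply Finset.sum_le_sum
    intro i hi
    exact pow_le_pow_of_le_one hr0 hr1.le (by omega)
  have h6 : (∑ j ∈ Finset.range N, r ^ (N - j)) * δ N ≤ G * δ N :=
    mul_le_mul_of_nonneg_right h5 (abs_nonneg _)
  simp only [Finset.sum_const, Finset.card_range, nsmul_eq_mul]
  have h7 : 4 / c * G * (δ N + α * N) = 2 / c * (2 * (G * δ N) + (N : ℝ) * (2 * α * G)) := by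
    field_simp; ring
  have h8 : 0 ≤ G * δ N := mul_nonneg hGpos.le (abs_nonneg _)
  refine le_trans ?_ h7.ge
  apply mul_le_mul_of_nonneg_left _ (by positivity)
  linarith

/-- Uncertainty of a point which enters the critical region `k` steps later with prescribed
signs of the orbit. -/
def uncertainty (α : ℝ) : ℕ → ℝ
  | 0 => 4 * α ^ (0.6 : ℝ)
  | k + 1 => √(uncertainty α k + 2 * α)

lemma tendsto_uncertainty (k : ℕ) :
    Tendsto (fun α => uncertainty α k) (nhds 0) (nhds 0) := by
  induction k with
  | zero =>
    have h : ContinuousAt (fun α : ℝ => 4 * α ^ (0.6 : ℝ)) 0 :=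
      (Real.continuousAt_rpow_const _ _ (Or.inr (by norm_num))).const_mul 4
    have h' := h.tendsto
    rw [Real.zero_rpow (by norm_num), mul_zero] at h'
    exact h'
  | succ k ih =>
    have h1 : Tendsto (fun α : ℝ => uncertainty α k + 2 * α) (nhds 0) (nhds 0) := by
      have := ih.add ((continuous_const_mul (2 : ℝ)).tendsto 0)
      simpa using this
    have h2 := (Real.continuous_sqrt.tendsto 0).comp h1
    simpa [uncertainty, Function.comp_def] using h2

lemma uncertainty_nonneg {α : ℝ} (hα : 0 < α) (k : ℕ) : 0 ≤ uncertainty α k := by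
  cases k with
  | zero => simp only [uncertainty]; positivity
  | succ k => exact Real.sqrt_nonneg _

lemma sub_le_uncertainty {α : ℝ} {x y : ℕ → ℝ}
    (hxy : ∀ n, |x n - y n| * |x n + y n| ≤ |x (n + 1) - y (n + 1)| + 2 * α) (j s : ℕ)
    (hsign : ∀ i, s ≤ i → i < s + j → (0 ≤ x i ↔ 0 ≤ y i))
    (hxj : |x (s + j)| ≤ 2 * α ^ (0.6 : ℝ)) (hyj : |y (s + j)| ≤ 2 * α ^ (0.6 : ℝ)) :
    |x s - y s| ≤ uncertainty α j := by
  induction j generalizing s with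
  | zero =>
    have := abs_sub (x s) (y s)
    simp only [add_zero] at hxj hyj
    simp only [uncertainty]
    linarith
  | succ j ih =>
    have h1 := ih (s + 1) (fun i h1 h2 => hsign i (by omega) (by omega))
      (by rwa [show s + 1 + j = s + (j + 1) by ring]) (by rwa [show s + 1 + j = s + (j + 1) by ring])
    have h2 : |x s - y s| ≤ |x s + y s| := by
      have := hsign s le_rfl (by omega)
      apply sq_le_sq.1
      by_cases h : 0 ≤ x s
      · nlinarith [this.1 h]
      · have h' : ¬ 0 ≤ y s := fun h'' => h (this.2 h'')
        push Not at h h'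
        nlinarith
    apply Real.le_sqrt_of_sq_le
    have h3 := hxy s
    nlinarith [abs_nonneg (x s - y s)]

/-- If two pairs of orbits enter the critical region shortly after time `N(α)` with the same
combinatorics, then the initial displacements of the two pairs, in units of `α`, almost agree. -/
lemma exists_displacement_sub_le {a ξ₀ c σ : ℝ} (hξ₀ : 0 < ξ₀)
    (hcrit : ∀ i : ℕ, 1 ≤ i → (qm a)^[i] 0 ∉ Set.Ioo (-(2 * ξ₀)) (2 * ξ₀))
    (hc : 0 < c) (hσ : 1 < σ)
    (hgrow : ∀ j k : ℕ, j ≤ k →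
      c * σ ^ (k - j) ≤ ∏ i ∈ Finset.Ico j k, 2 * |(qm a)^[i + 1] 0|)
    (M : ℕ) {ε : ℝ} (hε : 0 < ε) :
    ∃ α₀ > 0, ∀ α : ℝ, 0 < α → α < α₀ → ∀ e e' x x' y y' : ℕ → ℝ,
      (∀ n, |e n| ≤ α) → (∀ n, |e' n| ≤ α) →
      (∀ n, x (n + 1) = qm a (x n) + e n) → (∀ n, x' (n + 1) = qm a (x' n) + e n) →
      (∀ n, y (n + 1) = qm a (y n) + e' n) → (∀ n, y' (n + 1) = qm a (y' n) + e' n) →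
      x 0 ∈ shadow a α 0 → x' 0 ∈ shadow a α 0 → y 0 ∈ shadow a α 0 → y' 0 ∈ shadow a α 0 →
      ∀ j < M, ∀ j' < M,
      |x (Nal a ξ₀ α + j)| ≤ 2 * α ^ (0.6 : ℝ) → |y (Nal a ξ₀ α + j)| ≤ 2 * α ^ (0.6 : ℝ) →
      |x' (Nal a ξ₀ α + j')| ≤ 2 * α ^ (0.6 : ℝ) → |y' (Nal a ξ₀ α + j')| ≤ 2 * α ^ (0.6 : ℝ) →
      (∀ i < M, (0 ≤ x (Nal a ξ₀ α + i) ↔ 0 ≤ y (Nal a ξ₀ α + i))) →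
      (∀ i < M, (0 ≤ x' (Nal a ξ₀ α + i) ↔ 0 ≤ y' (Nal a ξ₀ α + i))) →
      ∀ u v : ℝ, x 0 - x' 0 = α * u → y 0 - y' 0 = α * v → |v| ≤ 6 → |u - v| ≤ ε := by
  obtain ⟨K, hK, hscale⟩ := exists_le_mul_prod_at_Nal hξ₀ hcrit hc hσ hgrow
  obtain ⟨C, hC, hsum⟩ := exists_sum_sub_le hξ₀ hcrit hc hσ hgrow
  obtain ⟨L, hL, hNal⟩ := exists_Nal_bound hξ₀ hcrit hc hσ hgrow
  let η : ℝ → ℝ := fun α => ∑ j ∈ Finset.range M, uncertainty α j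
  have hη : Tendsto η (nhds 0) (nhds 0) := by
    have := tendsto_finsetSum (Finset.range M) fun j _ => tendsto_uncertainty j
    simpa using this
  let D : ℝ → ℝ := fun α => 2 * η α * (2 * K / ξ₀) +
    (Real.exp (2 * (C * (η α + √α * √L)) / (2 * ξ₀)) - 1) * 6
  have hD : Tendsto D (nhds 0) (nhds 0) := by
    have h1 : Tendsto (fun α => √α * √L) (nhds 0) (nhds 0) := by
      have := (Real.continuous_sqrt.tendsto 0).mul_const (√L)
      simpa using this
    have h2 : Tendsto (fun α => 2 * (C * (η α + √α * √L)) / (2 * ξ₀)) (nhds 0) (nhds 0) := by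
      have := (((hη.add h1).const_mul C).const_mul 2).div_const (2 * ξ₀)
      simpa using this
    have h3 := (Real.continuous_exp.tendsto 0).comp h2
    have := ((hη.const_mul 2).mul_const (2 * K / ξ₀)).add ((h3.sub_const 1).mul_const 6)
    simpa [D, Function.comp_def] using this
  obtain ⟨α₁, hα₁, hball⟩ := Metric.eventually_nhds_iff.1 (hD.eventually (gt_mem_nhds hε))
  refine ⟨min α₁ 1, by positivity, ?_⟩
  intro α hα hαlt e e' x x' y y' he he' hx hx' hy hy' hx0 hx'0 hy0 hy'0 j hj j' hj'
    hxj hyj hx'j hy'j hs hs' u v hu hv hv6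
  set N := Nal a ξ₀ α with hN
  have hDα : D α < ε := hball (by
    rw [Real.dist_eq, sub_zero, abs_of_pos hα]; exact hαlt.trans_le (min_le_left _ _))
  refine le_trans ?_ hDα.le
  have hα1 : α ≤ 1 := hαlt.le.trans (min_le_right _ _)
  have hαN : α * N ≤ √α * √L := by
    rw [← Real.sqrt_mul hα.le]
    apply Real.le_sqrt_of_sq_le
    have := mul_le_mul_of_nonneg_left (hNal α hα hα1) hα.le
    linarith
  have mem : ∀ {z f : ℕ → ℝ}, (∀ n, |f n| ≤ α) → (∀ n, z (n + 1) = qm a (z n) + f n) →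
      z 0 ∈ shadow a α 0 → ∀ n, z n ∈ shadow a α n := by
    intro z f hf hz hz0 n
    induction n with
    | zero => exact hz0
    | succ n ih => rw [hz]; exact mem_shadow_succ ih (hf n)
  have mx := mem he hx hx0
  have mx' := mem he hx' hx'0
  have my := mem he' hy hy0
  have my' := mem he' hy' hy'0
  have rec_le : ∀ {z w : ℕ → ℝ}, (∀ n, z (n + 1) = qm a (z n) + e n) →
      (∀ n, w (n + 1) = qm a (w n) + e' n) →
      ∀ n, |z n - w n| * |z n + w n| ≤ |z (n + 1) - w (n + 1)| + 2 * α := by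
    intro z w hz hw n
    rw [← abs_mul]
    have h1 : (z n - w n) * (z n + w n) = -(z (n + 1) - w (n + 1)) + (e n - e' n) := by
      rw [hz, hw, qm, qm]; ring
    rw [h1]
    have h2 := abs_add_le (-(z (n + 1) - w (n + 1))) (e n - e' n)
    have h3 := abs_sub (e n) (e' n)
    rw [abs_neg] at h2
    linarith [he n, he' n]
  have hunc : ∀ {k : ℕ}, k < M → uncertainty α k ≤ η α := fun {k} hk =>
    Finset.single_le_sum (f := fun k => uncertainty α k) (fun i _ => uncertainty_nonneg hα i)
      (Finset.mem_range.2 hk)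
  have δN : |x N - y N| ≤ η α := by
    refine (sub_le_uncertainty (rec_le hx hy) j N ?_ hxj hyj).trans (hunc hj)
    intro i h1 h2
    have := hs (i - N) (by omega)
    rwa [Nat.add_sub_cancel' h1] at this
  have δ'N : |x' N - y' N| ≤ η α := by
    refine (sub_le_uncertainty (rec_le hx' hy') j' N ?_ hx'j hy'j).trans (hunc hj')
    intro i h1 h2
    have := hs' (i - N) (by omega)
    rwa [Nat.add_sub_cancel' h1] at this
  have S := hsum α hα x y (fun n _ => mx n) (fun n _ => my n) fun n _ => rec_le hx hy n
  have S' := hsum α hα x' y' (fun n _ => mx' n) (fun n _ => my' n) fun n _ => rec_le hx' hy' n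
  rw [← hN] at S S'
  have diff : ∀ {z w f : ℕ → ℝ}, (∀ n, z (n + 1) = qm a (z n) + f n) →
      (∀ n, w (n + 1) = qm a (w n) + f n) → ∀ n,
      z n - w n = (-1) ^ n * (∏ i ∈ Finset.range n, (z i + w i)) * (z 0 - w 0) := by
    intro z w f hz hw n
    induction n with
    | zero => simp
    | succ n ih =>
      rw [hz, hw, Finset.prod_range_succ, pow_succ]
      have : qm a (z n) + f n - (qm a (w n) + f n) = -(z n + w n) * (z n - w n) := by
        rw [qm, qm]; ring
      rw [this, ih]; ring
  have Dx := diff hx hx' N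
  have Dy := diff hy hy' N
  rw [hu] at Dx
  rw [hv] at Dy
  set Qx := ∏ i ∈ Finset.range N, (x i + x' i) with hQx
  set Qy := ∏ i ∈ Finset.range N, (y i + y' i) with hQy
  have hlow : ∀ i < N, 2 * ξ₀ ≤ |x i + x' i| := by
    intro i hi
    have h1 := le_abs_add_of_mem_shadow hα (mx i) (mx' i)
    have h2 := four_mul_le_of_avoid hcrit i
    have h3 := (Nal_spec (a := a) hξ₀ hα).1 i hi
    linarith
  have hne : ∀ i < N, x i + x' i ≠ 0 := fun i hi h0 => by
    have := hlow i hi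
    rw [h0, abs_zero] at this
    linarith
  have hQxne : Qx ≠ 0 := Finset.prod_ne_zero_iff.2 fun i hi => hne i (Finset.mem_range.1 hi)
  have hQ : ξ₀ ≤ 2 * K * (α * |Qx|) := by
    have h1 := half_prod_le_prod hξ₀ hα hcrit (j := 0) le_rfl (s := fun n => |x n + x' n|)
      fun n _ => le_abs_add_of_mem_shadow hα (mx n) (mx' n)
    rw [← Finset.abs_prod, Finset.prod_Ico_eq_prod_range _ 0, Nat.sub_zero] at h1
    simp only [zero_add, Nat.Ico_zero_eq_range] at h1
    have h2 := hscale α hα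
    rw [Nat.Ico_zero_eq_range] at h2
    refine h2.trans ?_
    rw [mul_assoc 2 K, ← mul_left_comm K 2]
    apply mul_le_mul_of_nonneg_left _ hK.le
    rw [← mul_left_comm α 2]
    apply mul_le_mul_of_nonneg_left _ hα.le
    linarith
  have hratio : |Qy / Qx - 1| ≤ Real.exp (2 * (C * (η α + √α * √L)) / (2 * ξ₀)) - 1 := by
    have h1 : Qy / Qx =
        ∏ i ∈ Finset.range N, (1 + ((y i + y' i) - (x i + x' i)) / (x i + x' i)) := by
      rw [hQy, hQx, ← Finset.prod_div_distrib]
      apply Finset.prod_congr rfl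
      intro i hi
      have := hne i (Finset.mem_range.1 hi)
      field_simp
      ring
    have h2 := Finset.norm_prod_one_add_sub_one_le (Finset.range N)
      fun i => ((y i + y' i) - (x i + x' i)) / (x i + x' i)
    rw [← h1, Real.norm_eq_abs] at h2
    refine h2.trans (sub_le_sub_right (Real.exp_le_exp.2 ?_) 1)
    have h3 : ∑ i ∈ Finset.range N, ‖((y i + y' i) - (x i + x' i)) / (x i + x' i)‖ ≤
        ∑ i ∈ Finset.range N, (|x i - y i| + |x' i - y' i|) / (2 * ξ₀) := by
      apply Finset.sum_le_sum
      intro i hi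
      rw [Real.norm_eq_abs, abs_div]
      apply div_le_div₀ (by positivity) _ (by positivity) (hlow i (Finset.mem_range.1 hi))
      have h4 : y i + y' i - (x i + x' i) = -((x i - y i) + (x' i - y' i)) := by ring
      rw [h4, abs_neg]
      exact abs_add_le _ _
    refine h3.trans ?_
    rw [← Finset.sum_div, Finset.sum_add_distrib]
    apply div_le_div_of_nonneg_right _ (by positivity)
    have h5 : C * (|x N - y N| + α * N) ≤ C * (η α + √α * √L) := by gcongr
    have h6 : C * (|x' N - y' N| + α * N) ≤ C * (η α + √α * √L) := by gcongr
    linarith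
  have hfin : u - v = (-1) ^ N * ((x N - y N) - (x' N - y' N)) / (α * Qx) +
      (Qy / Qx - 1) * v := by
    have h1 : (x N - y N) - (x' N - y' N) =
        (-1) ^ N * Qx * (α * u) - (-1) ^ N * Qy * (α * v) := by
      rw [← Dx, ← Dy]; ring
    have h2 : ((-1 : ℝ) ^ N) * (-1) ^ N = 1 := by rw [← mul_pow]; simp
    rw [h1]
    field_simp
    linear_combination (u * Qx - v * Qy) * (- h2)
  rw [hfin]
  refine (abs_add_le _ _).trans (add_le_add ?_ ?_)
  · rw [abs_div, abs_mul, abs_pow, abs_neg, abs_one, one_pow, one_mul, abs_mul, abs_of_pos hα]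
    have h1 := abs_sub (x N - y N) (x' N - y' N)
    have h2 : 0 < α * |Qx| := by positivity
    rw [div_le_iff₀ h2]
    have h3 : 1 ≤ 2 * K / ξ₀ * (α * |Qx|) := by
      rw [div_mul_eq_mul_div, one_le_div hξ₀]; exact hQ
    have h4 : 0 ≤ η α := (abs_nonneg _).trans δN
    nlinarith
  · rw [abs_mul]
    exact mul_le_mul hratio hv6 (abs_nonneg _) ((abs_nonneg _).trans hratio)

lemma exists_periodic_not_periodic {φ : ℝ → ℝ} (hφ : Continuous φ) {d : ℕ} (hd : 2 ≤ d)
    (hp : Function.Periodic φ 1) (hnc : ∃ s t : ℝ, φ s ≠ φ t) :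
    ∃ k : ℕ, Function.Periodic φ (1 / (d : ℝ) ^ k) ∧
      ¬ Function.Periodic φ (1 / (d : ℝ) ^ (k + 1)) := by
  by_contra! h
  have hall : ∀ k : ℕ, Function.Periodic φ (1 / (d : ℝ) ^ k) := by
    intro k
    induction k with
    | zero => simpa using hp
    | succ k ih => exact h k ih
  obtain ⟨s, t, hst⟩ := hnc
  apply hst
  have hd1 : (1 : ℝ) < d := by exact_mod_cast hd
  have hpow : Tendsto (fun k : ℕ => 1 / (d : ℝ) ^ k) atTop (nhds 0) := by
    have := tendsto_pow_atTop_nhds_zero_of_lt_one (r := 1 / (d : ℝ)) (by positivity)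
      ((div_lt_one (by linarith)).2 hd1)
    simpa [one_div, inv_pow] using this
  have hlim : Tendsto (fun k : ℕ => s + ⌊(t - s) * (d : ℝ) ^ k⌋ * (1 / (d : ℝ) ^ k)) atTop
      (nhds t) := by
    rw [tendsto_iff_dist_tendsto_zero]
    refine squeeze_zero (fun _ => dist_nonneg) (fun k => ?_) hpow
    have hk : 0 < (d : ℝ) ^ k := by positivity
    have h1 := Int.floor_le ((t - s) * (d : ℝ) ^ k)
    have h2 := Int.lt_floor_add_one ((t - s) * (d : ℝ) ^ k)
    have h3 : s + ⌊(t - s) * (d : ℝ) ^ k⌋ * (1 / (d : ℝ) ^ k) - t =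
        (⌊(t - s) * (d : ℝ) ^ k⌋ - (t - s) * (d : ℝ) ^ k) / (d : ℝ) ^ k := by
      field_simp
      ring
    rw [Real.dist_eq, h3, abs_div, abs_of_pos hk]
    apply div_le_div_of_nonneg_right _ hk.le
    rw [abs_le]
    constructor <;> linarith
  have h4 := (hφ.tendsto t).comp hlim
  have h5 : (φ ∘ fun k : ℕ => s + ⌊(t - s) * (d : ℝ) ^ k⌋ * (1 / (d : ℝ) ^ k)) =
      fun _ => φ s := by
    funext k
    exact (hall k).int_mul _ s
  rw [h5] at h4
  exact tendsto_nhds_unique tendsto_const_nhds h4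

lemma volume_level_set_sub_eq_zero {φ : ℝ → ℝ} (hφ : ∀ x, AnalyticAt ℝ φ x) {q : ℕ} (hq : 0 < q)
    (hp : Function.Periodic φ 1) (hnp : ¬ Function.Periodic φ (1 / q)) (c : ℝ) :
    volume {θ | φ θ - φ (θ + 1 / q) = c} = 0 := by
  have hψ : AnalyticOnNhd ℝ (fun θ => φ θ - φ (θ + 1 / q)) univ := fun x _ =>
    (hφ x).sub (AnalyticAt.fun_comp (hφ _) (analyticAt_id.add analyticAt_const))
  obtain ⟨x, hx⟩ : ∃ x, φ x - φ (x + 1 / q) - c ≠ 0 := by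
    by_contra! heq
    have hadd : ∀ n : ℕ, ∀ θ, φ θ - φ (θ + n * (1 / q)) = n * c := by
      intro n
      induction n with
      | zero => simp
      | succ n ih =>
        intro θ
        have h1 := ih θ
        have h2 := heq (θ + n * (1 / q))
        have h3 : θ + n * (1 / (q : ℝ)) + 1 / q = θ + ((n + 1 : ℕ) : ℝ) * (1 / q) := by
          push_cast; ring
        rw [h3] at h2
        push_cast at h2 ⊢
        linarith
    have hq0 : (q : ℝ) ≠ 0 := by positivity
    have hc : c = 0 := by
      have := hadd q 0
      rw [mul_one_div_cancel hq0, hp 0, sub_self] at this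
      exact (mul_eq_zero.1 this.symm).resolve_left hq0
    refine hnp fun θ => ?_
    have := heq θ
    linarith
  have hcd := (hψ.sub (analyticOnNhd_const (v := c))).preimage_zero_mem_codiscrete hx
  have hae := ae_restrict_le_codiscreteWithin (μ := volume) MeasurableSet.univ hcd
  rw [Measure.restrict_univ] at hae
  refine measure_mono_null (fun θ hθ => ?_) hae
  exact fun h => h (sub_eq_zero.2 hθ)

lemma exists_forall_measure_le {μ : Measure ℝ} [IsFiniteMeasure μ] [NullSingletonClass μ] {K : Set ℝ}
    (hK : IsCompact K) {η : ℝ≥0∞} (hη : 0 < η) :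
    ∃ ε > 0, ∀ v ∈ K, μ (Metric.closedBall v ε) ≤ η := by
  have h : ∀ v : ℝ, ∃ δ > 0, μ (Metric.ball v δ) < η := by
    intro v
    have h1 := tendsto_measure_thickening_of_isClosed (μ := μ) (s := {v})
      ⟨1, one_pos, measure_ne_top _ _⟩ isClosed_singleton
    rw [measure_singleton] at h1
    obtain ⟨δ, h2, h3⟩ := ((h1.eventually (gt_mem_nhds hη)).and self_mem_nhdsWithin).exists
    exact ⟨δ, h3, by rwa [Metric.thickening_singleton] at h2⟩
  choose δ hδ hμ using h
  obtain ⟨ε, hε, hball⟩ := lebesgue_number_lemma_of_metric hK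
    (fun v => Metric.isOpen_ball (x := v) (ε := δ v))
    fun v _ => mem_iUnion.2 ⟨v, Metric.mem_ball_self (hδ v)⟩
  refine ⟨ε / 2, by positivity, fun v hv => ?_⟩
  obtain ⟨w, hw⟩ := hball v hv
  exact (measure_mono ((Metric.closedBall_subset_ball (by linarith)).trans hw)).trans (hμ w).le

lemma exists_forall_volume_sub_near_le {φ : ℝ → ℝ} (hφ : ∀ x, AnalyticAt ℝ φ x) {q : ℕ}
    (hq : 0 < q) (hp : Function.Periodic φ 1) (hnp : ¬ Function.Periodic φ (1 / q))
    {K : Set ℝ} (hK : IsCompact K) {η : ℝ≥0∞} (hη : 0 < η) :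
    ∃ ε > 0, ∀ v ∈ K,
      volume {θ | θ ∈ Ico (0 : ℝ) 1 ∧ |φ θ - φ (θ + 1 / q) - v| ≤ ε} ≤ η := by
  have hφc : Continuous φ := continuous_iff_continuousAt.2 fun x => (hφ x).continuousAt
  have hmeas : Measurable fun θ => φ θ - φ (θ + 1 / q) := by
    apply Continuous.measurable
    fun_prop
  let μ := (volume.restrict (Ico (0 : ℝ) 1)).map fun θ => φ θ - φ (θ + 1 / q)
  have : NullSingletonClass μ := ⟨fun c => by
    rw [Measure.map_apply hmeas (measurableSet_singleton c)]
    exact Measure.absolutelyContinuous_of_le Measure.restrict_le_self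
      (volume_level_set_sub_eq_zero hφ hq hp hnp c)⟩
  obtain ⟨ε, hε, h⟩ := exists_forall_measure_le (μ := μ) hK hη
  refine ⟨ε, hε, fun v hv => le_trans (le_of_eq ?_) (h v hv)⟩
  rw [Measure.map_apply hmeas Metric.isClosed_closedBall.measurableSet,
    Measure.restrict_apply (hmeas Metric.isClosed_closedBall.measurableSet), inter_comm]
  rfl

section FibreMaps

variable {a : ℝ} {d : ℕ} {φ : ℝ → ℝ} {α : ℝ}

lemma viana_iterate (n : ℕ) (θ x : ℝ) :
    (Viana a d φ α)^[n] (θ, x) = ((d : ℝ) ^ n * θ, fn a d φ α n θ x) := by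
  refine Prod.ext ?_ rfl
  induction n with
  | zero => simp
  | succ n ih =>
    rw [Function.iterate_succ_apply', Viana, ih, pow_succ']
    ring

@[simp] lemma fn_zero (θ x : ℝ) : fn a d φ α 0 θ x = x := rfl

lemma fn_succ (n : ℕ) (θ x : ℝ) :
    fn a d φ α (n + 1) θ x = qm a (fn a d φ α n θ x) + α * φ ((d : ℝ) ^ n * θ) := by
  conv_lhs => rw [fn, Function.iterate_succ_apply', viana_iterate]
  rfl

lemma fn_add (m n : ℕ) (θ x : ℝ) :
    fn a d φ α (m + n) θ x = fn a d φ α m ((d : ℝ) ^ n * θ) (fn a d φ α n θ x) := by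
  conv_lhs => rw [fn, Function.iterate_add_apply, viana_iterate n]
  rfl

lemma fn_add_nat (hp : Function.Periodic φ 1) (n j : ℕ) (θ x : ℝ) :
    fn a d φ α n (θ + j) x = fn a d φ α n θ x := by
  induction n with
  | zero => rfl
  | succ n ih =>
    rw [fn_succ, fn_succ, ih]
    have := hp.nat_mul (d ^ n * j) ((d : ℝ) ^ n * θ)
    rw [← this]
    congr 3
    push_cast
    ring

lemma differentiable_fn (n : ℕ) (θ : ℝ) : Differentiable ℝ fun x => fn a d φ α n θ x := by
  induction n with
  | zero => exact differentiable_id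
  | succ n ih =>
    simp only [fn_succ, qm]
    fun_prop

end FibreMaps

lemma exists_fn_mem_Icc {a β : ℝ} (hβ : 1 < β)
    (hβmap : ∀ x ∈ Set.Icc (-β) β, qm a x ∈ Set.Ioo (-β) β) {φ : ℝ → ℝ} (hφb : ∀ θ, |φ θ| ≤ 1)
    (d : ℕ) :
    ∃ α₀ > 0, ∀ α : ℝ, 0 < α → α < α₀ → ∀ θ x : ℝ, x ∈ Icc (-β) β → ∀ n,
      fn a d φ α n θ x ∈ Icc (-β) β := by
  have h0 := hβmap 0 ⟨by linarith, by linarith⟩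
  have h1 := hβmap β ⟨by linarith, le_rfl⟩
  simp only [qm, mem_Ioo] at h0 h1
  refine ⟨min (β - a) (a - β ^ 2 + β), lt_min (by linarith) (by linarith), ?_⟩
  intro α hα hlt θ x hx n
  have h2 := hlt.trans_le (min_le_left _ _)
  have h3 := hlt.trans_le (min_le_right _ _)
  induction n with
  | zero => exact hx
  | succ n ih =>
    rw [fn_succ, qm]
    have h4 := abs_le.1 (hφb ((d : ℝ) ^ n * θ))
    have h5 : fn a d φ α n θ x ^ 2 ≤ β ^ 2 := sq_le_sq' ih.1 ih.2
    constructor <;> nlinarith [sq_nonneg (fn a d φ α n θ x)]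

lemma exists_lipschitz_of_analytic_periodic {φ : ℝ → ℝ} (hφ : ∀ x, AnalyticAt ℝ φ x)
    (hp : Function.Periodic φ 1) : ∃ L > 0, ∀ s t, |φ s - φ t| ≤ L * |s - t| := by
  have hc : Continuous (deriv φ) :=
    continuous_iff_continuousAt.2 fun x => (hφ x).deriv.continuousAt
  have hdp : Function.Periodic (deriv φ) 1 := by
    intro x
    rw [← deriv_comp_add_const]
    congr 1
    funext y
    exact hp y
  obtain ⟨C, hC⟩ := isBounded_iff_forall_norm_le.1
    (hdp.isBounded_of_continuous one_ne_zero hc)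
  refine ⟨max C 1, by positivity, fun s t => ?_⟩
  have := convex_univ.norm_image_sub_le_of_norm_deriv_le (f := φ) (C := max C 1)
    (fun x _ => (hφ x).differentiableAt)
    (fun x _ => (hC _ (mem_range_self x)).trans (le_max_left _ _)) (mem_univ t) (mem_univ s)
  simpa only [Real.norm_eq_abs] using this

/-- Horizontal curves stay nearly horizontal, as the base expands more than the fibres. -/
lemma abs_fn_sub_fn_le {a : ℝ} {d : ℕ} (hd : 2 ≤ d) {φ : ℝ → ℝ} {α β L C R : ℝ}
    (hα : 0 < α) (hL : ∀ s t, |φ s - φ t| ≤ L * |s - t|) (hL0 : 0 < L) (hC : 0 < C)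
    (hR : R ∈ Ioo (0 : ℝ) 2)
    (hB : ∀ θ x : ℝ, x ∈ Icc (-β) β → ∀ n, fn a d φ α n θ x ∈ Icc (-β) β)
    (hder : ∀ θ x : ℝ, x ∈ Icc (-β) β → ∀ k : ℕ,
      |deriv (fun y => fn a d φ α k θ y) x| ≤ C * R ^ k)
    (n : ℕ) (s t x : ℝ) (hx : x ∈ Icc (-β) β) :
    |fn a d φ α n s x - fn a d φ α n t x| ≤ L * C / (d - R) * α * (d : ℝ) ^ n * |s - t| := by
  have hd2 : (2 : ℝ) ≤ d := by exact_mod_cast hd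
  have hdR : 0 < (d : ℝ) - R := by linarith [hR.2]
  have key : |fn a d φ α n s x - fn a d φ α n t x| ≤
      L * C / (d - R) * α * ((d : ℝ) ^ n - R ^ n) * |s - t| := by
    induction n generalizing s t x with
    | zero => simp
    | succ n ih =>
      rw [fn_add n 1, fn_add n 1, pow_one]
      set p := fn a d φ α 1 s x
      set q := fn a d φ α 1 t x
      have hp : p ∈ Icc (-β) β := hB s x hx 1
      have hq : q ∈ Icc (-β) β := hB t x hx 1
      have hpq : |p - q| ≤ α * (L * |s - t|) := by
        have : p - q = α * (φ s - φ t) := by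
          simp only [p, q, fn_succ, fn_zero, pow_zero, one_mul]; ring
        rw [this, abs_mul, abs_of_pos hα]
        exact mul_le_mul_of_nonneg_left (hL s t) hα.le
      have h1 := (convex_Icc (-β) β).norm_image_sub_le_of_norm_deriv_le
        (f := fun y => fn a d φ α n (d * s) y) (C := C * R ^ n)
        (fun y _ => differentiable_fn n _ y) (fun y hy => hder _ y hy n) hq hp
      simp only [Real.norm_eq_abs] at h1
      have h2 := ih (d * s) (d * t) q hq
      have h3 : |(d : ℝ) * s - d * t| = d * |s - t| := by
        rw [← mul_sub, abs_mul, abs_of_pos (by linarith : (0 : ℝ) < d)]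
      rw [h3] at h2
      have h4 : C * R ^ n * |p - q| ≤ C * R ^ n * (α * (L * |s - t|)) :=
        mul_le_mul_of_nonneg_left hpq (by have := hR.1; positivity)
      have h5 := abs_sub_le (fn a d φ α n (d * s) p) (fn a d φ α n (d * s) q)
        (fn a d φ α n (d * t) q)
      have h6 : L * C / (d - R) * α * ((d : ℝ) ^ (n + 1) - R ^ (n + 1)) * |s - t| =
          C * R ^ n * (α * (L * |s - t|)) +
            L * C / (d - R) * α * ((d : ℝ) ^ n - R ^ n) * (d * |s - t|) := by
        field_simp
        ring
      linarith
  refine key.trans ?_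
  have := hR.1
  have h7 : (d : ℝ) ^ n - R ^ n ≤ (d : ℝ) ^ n := by
    have : 0 < R ^ n := by positivity
    linarith
  gcongr

section Curves

variable {a : ℝ} {d : ℕ} {φ : ℝ → ℝ} {α β : ℝ} {n₀ : ℕ} {X : ℝ → ℝ}

/-- The curve obtained by applying `F^n` to the part of the graph of `X` over the `j`-th element
of `𝒫_n`. -/
def rescale (a : ℝ) (d : ℕ) (φ : ℝ → ℝ) (α : ℝ) (X : ℝ → ℝ) (n j : ℕ) : ℝ → ℝ :=
  fun t => fn a d φ α n ((t + j) / (d : ℝ) ^ n) (X ((t + j) / (d : ℝ) ^ n))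

lemma div_pow_mem_Ico (hd : 0 < d) {n j : ℕ} (hj : j < d ^ n) {t : ℝ} (ht : t ∈ Ico (0 : ℝ) 1) :
    (t + j) / (d : ℝ) ^ n ∈ Ico (0 : ℝ) 1 := by
  have hpos : (0 : ℝ) < (d : ℝ) ^ n := by positivity
  have hj' : (j : ℝ) + 1 ≤ (d : ℝ) ^ n := by exact_mod_cast hj
  exact ⟨div_nonneg (add_nonneg ht.1 (Nat.cast_nonneg _)) hpos.le,
    (div_lt_one hpos).2 (by linarith [ht.2])⟩

lemma fn_of_eq_fn (hd : 0 < d) (hp : Function.Periodic φ 1) {m j : ℕ} {x₀ θ : ℝ}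
    (hX : X θ = fn a d φ α m ((θ + j) / (d : ℝ) ^ m) x₀) (n : ℕ) :
    fn a d φ α n θ (X θ) = fn a d φ α (n + m) ((θ + j) / (d : ℝ) ^ m) x₀ := by
  have hpos : (0 : ℝ) < (d : ℝ) ^ m := by positivity
  rw [hX, fn_add n m, mul_div_cancel₀ _ hpos.ne', fn_add_nat hp]

lemma Admissible.rescale (hd : 0 < d) (hp : Function.Periodic φ 1)
    (hX : Admissible a d φ α β n₀ X) {n j : ℕ} (hj : j < d ^ n) :
    Admissible a d φ α β n₀ (rescale a d φ α X n j) := by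
  obtain ⟨m, hm, i, hi, x₀, hx₀, h⟩ := hX
  refine ⟨n + m, by omega, j + i * d ^ n, ?_, x₀, hx₀, fun t ht => ?_⟩
  · calc j + i * d ^ n < d ^ n + i * d ^ n := by omega
      _ = (i + 1) * d ^ n := by ring
      _ ≤ d ^ m * d ^ n := Nat.mul_le_mul_right _ hi
      _ = d ^ (n + m) := by ring
  · rw [_root_.rescale, fn_of_eq_fn hd hp (h _ (div_pow_mem_Ico hd hj ht))]
    congr 1
    have hd' : (d : ℝ) ≠ 0 := by positivity
    push_cast
    field_simp
    ring

lemma fn_rescale (hd : 0 < d) (hp : Function.Periodic φ 1) (k n j : ℕ) (t : ℝ) :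
    fn a d φ α k t (rescale a d φ α X n j t) =
      fn a d φ α (k + n) ((t + j) / (d : ℝ) ^ n) (X ((t + j) / (d : ℝ) ^ n)) :=
  fn_of_eq_fn (X := rescale a d φ α X n j) hd hp rfl k

lemma Admissible.abs_fn_sub_fn_le (hd : 0 < d) (hp : Function.Periodic φ 1)
    (hX : Admissible a d φ α β n₀ X) {C : ℝ}
    (hC : ∀ (n : ℕ) (s t x : ℝ), x ∈ Icc (-β) β →
      |fn a d φ α n s x - fn a d φ α n t x| ≤ C * α * (d : ℝ) ^ n * |s - t|)
    (n : ℕ) {s t : ℝ} (hs : s ∈ Ico (0 : ℝ) 1) (ht : t ∈ Ico (0 : ℝ) 1) :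
    |fn a d φ α n s (X s) - fn a d φ α n t (X t)| ≤ C * α * (d : ℝ) ^ n * |s - t| := by
  obtain ⟨m, hm, i, hi, x₀, hx₀, h⟩ := hX
  rw [fn_of_eq_fn hd hp (h s hs), fn_of_eq_fn hd hp (h t ht)]
  refine (hC (n + m) _ _ x₀ hx₀).trans (le_of_eq ?_)
  have hd' : (0 : ℝ) < (d : ℝ) ^ m := by positivity
  rw [← sub_div, abs_div, abs_of_pos hd', add_sub_add_right_eq_sub, pow_add]
  field_simp

lemma abs_sub_mul_pow_lt_one {n : ℕ} {s t : ℝ} (h : ⌊s * (d : ℝ) ^ n⌋ = ⌊t * (d : ℝ) ^ n⌋) :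
    (d : ℝ) ^ n * |s - t| ≤ 1 := by
  have := (Int.abs_sub_lt_one_of_floor_eq_floor h).le
  rw [← sub_mul, abs_mul, abs_of_nonneg (by positivity : (0 : ℝ) ≤ (d : ℝ) ^ n)] at this
  linarith

/-- On an element of `𝒫_n` with a return at time `n`, the whole image lies close to `0`. -/
lemma IsRet.abs_fn_le (hd : 0 < d) (hp : Function.Periodic φ 1) (hα : 0 < α)
    (hX : Admissible a d φ α β n₀ X)
    (hXB : MapsTo X (Ico (0 : ℝ) 1) (Icc (-(2 * α ^ (0.6 : ℝ))) (2 * α ^ (0.6 : ℝ)))) {C : ℝ}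
    (hC0 : 0 < C)
    (hC : ∀ (n : ℕ) (s t x : ℝ), x ∈ Icc (-β) β →
      |fn a d φ α n s x - fn a d φ α n t x| ≤ C * α * (d : ℝ) ^ n * |s - t|)
    (hCα : C * α ≤ α ^ (0.6 : ℝ)) {n : ℕ} {θ : ℝ} (hθ : θ ∈ Ico (0 : ℝ) 1)
    (h : IsRet a d φ α X θ n) : |fn a d φ α n θ (X θ)| ≤ 2 * α ^ (0.6 : ℝ) := by
  rcases h with rfl | ⟨-, θ', hθ', hfl, hle⟩
  · exact abs_le.2 (hXB hθ)
  · have h1 := hX.abs_fn_sub_fn_le hd hp hC n hθ hθ'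
    have h2 := abs_sub_mul_pow_lt_one hfl
    rw [abs_sub_comm] at h2
    have h3 : C * α * (d : ℝ) ^ n * |θ - θ'| ≤ C * α := by
      rw [mul_assoc]
      exact mul_le_of_le_one_right (by positivity) h2
    have h4 := abs_sub_abs_le_abs_sub (fn a d φ α n θ (X θ)) (fn a d φ α n θ' (X θ'))
    linarith

end Curves

lemma exists_rpow_lt {p ε : ℝ} (hp : 0 < p) (hε : 0 < ε) :
    ∃ α₀ > 0, ∀ α : ℝ, 0 < α → α < α₀ → α ^ p < ε := by
  refine ⟨ε ^ p⁻¹, by positivity, fun α hα hlt => ?_⟩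
  calc α ^ p < (ε ^ p⁻¹) ^ p := Real.rpow_lt_rpow hα.le hlt hp
    _ = ε := Real.rpow_inv_rpow hε.le hp.ne'

lemma two_mul_volume_le {E : Set ℝ} (hE : MeasurableSet E) (hE1 : E ⊆ Ico 0 1) {r : ℝ}
    (hr : r ∈ Icc (0 : ℝ) 1) :
    2 * volume E ≤ 1 + volume {θ | θ ∈ E ∧ (θ + r ∈ E ∨ θ + (r - 1) ∈ E)} := by
  set F₁ := (fun θ => θ + r) ⁻¹' (E ∩ Ici r) with hF₁
  set F₂ := (fun θ => θ + (r - 1)) ⁻¹' (E ∩ Iio r) with hF₂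
  have hm₁ : MeasurableSet F₁ := (measurable_add_const r) (hE.inter measurableSet_Ici)
  have hm₂ : MeasurableSet F₂ := (measurable_add_const (r - 1)) (hE.inter measurableSet_Iio)
  have hdisj : Disjoint F₁ F₂ := by
    rw [Set.disjoint_left]
    rintro θ ⟨h1, -⟩ ⟨h2, -⟩
    have := (hE1 h1).2
    have := (hE1 h2).1
    simp only at *
    linarith
  have hF : volume (F₁ ∪ F₂) = volume E := by
    rw [measure_union hdisj hm₂, hF₁, hF₂, measure_preimage_add_right, measure_preimage_add_right,
      ← measure_inter_add_sdiff E (measurableSet_Ici (a := r))]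
    congr 2
    ext θ
    simp
  have hsub : E ∪ (F₁ ∪ F₂) ⊆ Ico 0 1 := by
    rintro θ (h | ⟨h1, h2⟩ | ⟨h1, h2⟩)
    · exact hE1 h
    · have := (hE1 h1).2
      simp only [mem_Ici] at *
      exact ⟨by linarith, by linarith [hr.1]⟩
    · have := (hE1 h1).1
      simp only [mem_Iio] at *
      exact ⟨by linarith [hr.2], by linarith⟩
  have h1 := measure_union_add_inter (μ := volume) E (hm₁.union hm₂)
  rw [hF, ← two_mul] at h1
  rw [← h1]
  refine add_le_add ((measure_mono hsub).trans (by simp)) (measure_mono ?_)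
  rintro θ ⟨h, ⟨h1, -⟩ | ⟨h1, -⟩⟩
  exacts [⟨h, Or.inl h1⟩, ⟨h, Or.inr h1⟩]

section FastReturns

variable {a : ℝ} {d : ℕ} {φ : ℝ → ℝ} {α : ℝ} {X : ℝ → ℝ}

lemma isRet_congr {n : ℕ} {s t : ℝ} (h : ⌊s * (d : ℝ) ^ n⌋ = ⌊t * (d : ℝ) ^ n⌋) :
    IsRet a d φ α X s n ↔ IsRet a d φ α X t n := by
  rw [IsRet, IsRet, h]

lemma measurableSet_isRet (n : ℕ) : MeasurableSet {θ | IsRet a d φ α X θ n} := by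
  have hm : Measurable fun θ : ℝ => ⌊θ * (d : ℝ) ^ n⌋ :=
    Int.measurable_floor.comp (measurable_mul_const _)
  have : {θ | IsRet a d φ α X θ n} = (fun θ : ℝ => ⌊θ * (d : ℝ) ^ n⌋) ⁻¹'
      ((fun θ : ℝ => ⌊θ * (d : ℝ) ^ n⌋) '' {θ | IsRet a d φ α X θ n}) := by
    refine subset_antisymm (subset_preimage_image _ _) ?_
    rintro θ ⟨s, hs, hst⟩
    exact (isRet_congr hst).1 hs
  rw [this]
  exact hm (MeasurableSet.of_discrete)

/-- The parameters with a return among the first `B` iterates. -/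
def fastReturns (a : ℝ) (d : ℕ) (φ : ℝ → ℝ) (α : ℝ) (X : ℝ → ℝ) (B : ℕ) : Set ℝ :=
  {θ | θ ∈ Ico (0 : ℝ) 1 ∧ ∃ n, 1 ≤ n ∧ n ≤ B ∧ IsRet a d φ α X θ n}

lemma measurableSet_fastReturns (B : ℕ) : MeasurableSet (fastReturns a d φ α X B) := by
  have : fastReturns a d φ α X B =
      Ico 0 1 ∩ ⋃ n ∈ Icc 1 B, {θ | IsRet a d φ α X θ n} := by
    ext θ
    simp [fastReturns, and_assoc]
  rw [this]
  exact measurableSet_Ico.inter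
    (MeasurableSet.biUnion (to_countable _) fun n _ => measurableSet_isRet n)

lemma fn_one_mem_shadow (hφb : ∀ θ, |φ θ| ≤ 1) (hα : 0 < α) {θ x : ℝ} (hx : x ^ 2 ≤ α) :
    fn a d φ α 1 θ x ∈ shadow a α 0 := by
  have h := abs_le.1 (hφb θ)
  change _ ∈ Icc (qm a 0 - 2 * α) (qm a 0 + 2 * α)
  simp only [fn_succ, fn_zero, qm, pow_zero, one_mul]
  constructor <;> nlinarith [sq_nonneg x]

lemma fn_succ_mem_shadow (hφb : ∀ θ, |φ θ| ≤ 1) (hα : 0 < α) {θ x : ℝ} (hx : x ^ 2 ≤ α) (n : ℕ) :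
    fn a d φ α (n + 1) θ x ∈ shadow a α n := by
  induction n with
  | zero => exact fn_one_mem_shadow hφb hα hx
  | succ n ih =>
    rw [fn_succ]
    refine mem_shadow_succ ih ?_
    rw [abs_mul, abs_of_pos hα]
    exact mul_le_of_le_one_right hα.le (hφb _)

/-- There is no return before time `N(α)`. -/
lemma exists_fast_return_eq {ξ₀ : ℝ} (hξ₀ : 0 < ξ₀)
    (hcrit : ∀ i : ℕ, 1 ≤ i → (qm a)^[i] 0 ∉ Set.Ioo (-(2 * ξ₀)) (2 * ξ₀))
    (hφb : ∀ θ, |φ θ| ≤ 1) (hα : 0 < α) (hα' : 2 * α ^ (0.6 : ℝ) < ξ₀) {θ x : ℝ} (hx : x ^ 2 ≤ α)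
    {M n : ℕ} (hn : 1 ≤ n) (hnM : n ≤ Nal a ξ₀ α + M)
    (hle : |fn a d φ α n θ x| ≤ 2 * α ^ (0.6 : ℝ)) :
    ∃ j : Fin M, |fn a d φ α (Nal a ξ₀ α + j + 1) θ x| ≤ 2 * α ^ (0.6 : ℝ) := by
  obtain ⟨i, rfl⟩ : ∃ i, n = i + 1 := ⟨n - 1, by omega⟩
  have hi : Nal a ξ₀ α ≤ i := by
    by_contra! hlt
    have h1 := (Nal_spec (a := a) hξ₀ hα).1 i hlt
    have h2 := abs_sub_le_len (fn_succ_mem_shadow (a := a) (d := d) (θ := θ) hφb hα hx i)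
      (critical_mem_shadow (a := a) hα i)
    have h3 := four_mul_le_of_avoid hcrit i
    have h4 := abs_sub_abs_le_abs_sub ((qm a)^[i + 1] 0) (fn a d φ α (i + 1) θ x)
    rw [abs_sub_comm] at h4
    linarith
  obtain ⟨j, rfl⟩ := Nat.exists_eq_add_of_le hi
  exact ⟨⟨j, by omega⟩, hle⟩

end FastReturns

/-- Fast returns are unlikely. -/
lemma exists_volume_fastReturns_le {a ξ₀ c σ : ℝ} (hξ₀ : 0 < ξ₀)
    (hcrit : ∀ i : ℕ, 1 ≤ i → (qm a)^[i] 0 ∉ Set.Ioo (-(2 * ξ₀)) (2 * ξ₀))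
    (hc : 0 < c) (hσ : 1 < σ)
    (hgrow : ∀ j k : ℕ, j ≤ k →
      c * σ ^ (k - j) ≤ ∏ i ∈ Finset.Ico j k, 2 * |(qm a)^[i + 1] 0|)
    {d : ℕ} (hd : 2 ≤ d) {φ : ℝ → ℝ} (hφa : ∀ x : ℝ, AnalyticAt ℝ φ x)
    (hφp : Function.Periodic φ 1) (hφnc : ∃ s t : ℝ, φ s ≠ φ t) (hφb : ∀ θ : ℝ, |φ θ| ≤ 1)
    (M : ℕ) :
    ∃ α₀ > 0, ∀ α : ℝ, 0 < α → α < α₀ → ∀ X : ℝ → ℝ,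
      (∀ θ ∈ Ico (0 : ℝ) 1, |X θ| ≤ 2 * α ^ (0.6 : ℝ)) →
      (∀ θ ∈ Ico (0 : ℝ) 1, ∀ n, IsRet a d φ α X θ n →
        |fn a d φ α n θ (X θ)| ≤ 2 * α ^ (0.6 : ℝ)) →
      volume (fastReturns a d φ α X (Nal a ξ₀ α + M)) ≤ 2 / 3 := by
  have hφc : Continuous φ := continuous_iff_continuousAt.2 fun x => (hφa x).continuousAt
  obtain ⟨k, hk, hk'⟩ := exists_periodic_not_periodic hφc hd hφp hφnc
  set q := d ^ (k + 1) with hq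
  have hqpos : 0 < q := by positivity
  have hqcast : (q : ℝ) = (d : ℝ) ^ (k + 1) := by simp [hq]
  rw [← hqcast] at hk'
  set r : ℝ := 1 / q with hr
  have hr01 : r ∈ Icc (0 : ℝ) 1 := by
    refine ⟨by positivity, ?_⟩
    rw [hr, div_le_one (by positivity)]
    exact_mod_cast hqpos
  let Λ := (Fin M × Fin M) × ((Fin M → Prop) × (Fin M → Prop))
  let κ : ℝ≥0∞ := Fintype.card Λ
  obtain ⟨ε, hε, hnear⟩ := exists_forall_volume_sub_near_le hφa hqpos hφp hk'
    (isCompact_Icc (a := (-2 : ℝ)) (b := 2)) (η := (3 * (κ + 1))⁻¹)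
    (ENNReal.inv_pos.2 (ENNReal.mul_ne_top (by norm_num) (by simp [κ])))
  obtain ⟨α₁, hα₁, hdisp⟩ := exists_displacement_sub_le hξ₀ hcrit hc hσ hgrow M
    (ε := ε / 3) (by positivity)
  obtain ⟨α₂, hα₂, hsmall⟩ := exists_rpow_lt (p := 0.2) (ε := min (ε / 3) 1 / 4) (by norm_num)
    (by positivity)
  obtain ⟨α₃, hα₃, hsmall'⟩ := exists_rpow_lt (p := 0.6) (ε := ξ₀ / 2) (by norm_num)
    (by positivity)
  refine ⟨min α₁ (min α₂ α₃), by positivity, ?_⟩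
  intro α hα hlt X hX hret
  have hlt₁ : α < α₁ := hlt.trans_le (min_le_left _ _)
  have hlt₂ : α < α₂ := hlt.trans_le ((min_le_right _ _).trans (min_le_left _ _))
  have hlt₃ : α < α₃ := hlt.trans_le ((min_le_right _ _).trans (min_le_right _ _))
  have hξ : 2 * α ^ (0.6 : ℝ) < ξ₀ := by linarith [hsmall' α hα hlt₃]
  have hsq : ∀ θ ∈ Ico (0 : ℝ) 1, X θ ^ 2 ≤ α * min (ε / 3) 1 := by
    intro θ hθ
    have h1 := sq_le_sq' (abs_le.1 (hX θ hθ)).1 (abs_le.1 (hX θ hθ)).2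
    have h2 : (α ^ (0.6 : ℝ)) ^ 2 = α * α ^ (0.2 : ℝ) := by
      rw [← Real.rpow_natCast, ← Real.rpow_mul hα.le]
      nth_rw 2 [← Real.rpow_one α]
      rw [← Real.rpow_add hα]
      norm_num
    have h3 := mul_le_mul_of_nonneg_left (hsmall α hα hlt₂).le hα.le
    nlinarith
  have hsq' : ∀ θ ∈ Ico (0 : ℝ) 1, X θ ^ 2 ≤ α := fun θ hθ =>
    (hsq θ hθ).trans (mul_le_of_le_one_right hα.le (min_le_right _ _))
  set N := Nal a ξ₀ α with hN
  set E := fastReturns a d φ α X (N + M) with hE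
  let τ : ℝ → ℝ := fun θ => if θ + r < 1 then θ + r else θ + (r - 1)
  have hτ : ∀ θ, ∃ m : ℕ, τ θ + m = θ + r := by
    intro θ
    by_cases h : θ + r < 1
    · exact ⟨0, by simp [τ, h]⟩
    · exact ⟨1, by simp only [τ, if_neg h, Nat.cast_one]; ring⟩
  have hφτ : ∀ θ, ∀ i : ℕ, φ ((d : ℝ) ^ (i + 1) * τ θ) = φ ((d : ℝ) ^ (i + 1) * θ) := by
    intro θ i
    obtain ⟨m, hm⟩ := hτ θ
    rw [eq_sub_of_add_eq hm, ← (hφp.nat_mul (d ^ (i + 1) * m)) _,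
      ← hk.nat_mul (d ^ i) ((d : ℝ) ^ (i + 1) * θ)]
    congr 1
    rw [hr, hqcast]
    have : (d : ℝ) ≠ 0 := by positivity
    push_cast
    field_simp
    ring
  have hφτ0 : ∀ θ, φ (τ θ) = φ (θ + r) := by
    intro θ
    obtain ⟨m, hm⟩ := hτ θ
    rw [← hm]
    exact ((hφp.nat_mul m) (τ θ)).symm ▸ by simp
  let A : Λ → Set ℝ := fun l => {θ | θ ∈ Ico (0 : ℝ) 1 ∧ τ θ ∈ Ico (0 : ℝ) 1 ∧
    |fn a d φ α (N + l.1.1 + 1) θ (X θ)| ≤ 2 * α ^ (0.6 : ℝ) ∧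
    |fn a d φ α (N + l.1.2 + 1) (τ θ) (X (τ θ))| ≤ 2 * α ^ (0.6 : ℝ) ∧
    (∀ i : Fin M, 0 ≤ fn a d φ α (N + i + 1) θ (X θ) ↔ l.2.1 i) ∧
    ∀ i : Fin M, 0 ≤ fn a d φ α (N + i + 1) (τ θ) (X (τ θ)) ↔ l.2.2 i}
  have hA : ∀ l, volume (A l) ≤ (3 * (κ + 1))⁻¹ := by
    intro l
    rcases (A l).eq_empty_or_nonempty with h | ⟨s, hs⟩
    · rw [h, measure_empty]; exact zero_le
    let u : ℝ → ℝ := fun θ => φ θ - φ (θ + r) - (X θ ^ 2 - X (τ θ) ^ 2) / α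
    have hu : ∀ θ, fn a d φ α 1 θ (X θ) - fn a d φ α 1 (τ θ) (X (τ θ)) = α * u θ := by
      intro θ
      simp only [u, fn_succ, fn_zero, pow_zero, one_mul, qm, hφτ0]
      field_simp
      ring
    have hun : ∀ θ ∈ A l, |u θ - (φ θ - φ (θ + r))| ≤ min (ε / 3) 1 := by
      intro θ hθ
      have h1 := hsq θ hθ.1
      have h2 := hsq _ hθ.2.1
      have h3 : u θ - (φ θ - φ (θ + r)) = -((X θ ^ 2 - X (τ θ) ^ 2) / α) := by
        simp only [u]; ring
      rw [h3, abs_neg, abs_div, abs_of_pos hα, div_le_iff₀ hα, mul_comm, abs_le]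
      constructor <;> nlinarith [sq_nonneg (X θ), sq_nonneg (X (τ θ))]
    have hψ : ∀ θ, |φ θ - φ (θ + r)| ≤ 2 := fun θ =>
      (abs_sub _ _).trans (by linarith [hφb θ, hφb (θ + r)])
    refine le_trans (measure_mono fun θ hθ => ?_) (hnear _ (abs_le.1 (hψ s)))
    refine ⟨hθ.1, ?_⟩
    have hforce : ∀ (t : ℝ) (n : ℕ), |α * φ ((d : ℝ) ^ (n + 1) * t)| ≤ α := fun t n => by
      rw [abs_mul, abs_of_pos hα]
      exact mul_le_of_le_one_right hα.le (hφb _)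
    have h := hdisp α hα hlt₁ (fun n => α * φ ((d : ℝ) ^ (n + 1) * θ))
      (fun n => α * φ ((d : ℝ) ^ (n + 1) * s))
      (fun n => fn a d φ α (n + 1) θ (X θ)) (fun n => fn a d φ α (n + 1) (τ θ) (X (τ θ)))
      (fun n => fn a d φ α (n + 1) s (X s)) (fun n => fn a d φ α (n + 1) (τ s) (X (τ s)))
      (hforce θ) (hforce s)
      (fun n => fn_succ _ _ _) (fun n => by rw [fn_succ (n + 1), hφτ])
      (fun n => fn_succ _ _ _) (fun n => by rw [fn_succ (n + 1), hφτ])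
      (fn_one_mem_shadow hφb hα (hsq' _ hθ.1)) (fn_one_mem_shadow hφb hα (hsq' _ hθ.2.1))
      (fn_one_mem_shadow hφb hα (hsq' _ hs.1)) (fn_one_mem_shadow hφb hα (hsq' _ hs.2.1))
      l.1.1 l.1.1.2 l.1.2 l.1.2.2 hθ.2.2.1 hs.2.2.1 hθ.2.2.2.1 hs.2.2.2.1
      (fun i hi => (hθ.2.2.2.2.1 ⟨i, hi⟩).trans (hs.2.2.2.2.1 ⟨i, hi⟩).symm)
      (fun i hi => (hθ.2.2.2.2.2 ⟨i, hi⟩).trans (hs.2.2.2.2.2 ⟨i, hi⟩).symm)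
      (u θ) (u s) (hu θ) (hu s) ?_
    · have h1 := abs_le.1 ((hun θ hθ).trans (min_le_left _ _))
      have h2 := abs_le.1 ((hun s hs).trans (min_le_left _ _))
      have h3 := abs_le.1 h
      rw [abs_le]
      constructor <;> linarith
    · have h1 := abs_le.1 ((hun s hs).trans (min_le_right _ _))
      have h2 := abs_le.1 (hψ s)
      rw [abs_le]
      constructor <;> linarith
  have hcover : {θ | θ ∈ E ∧ (θ + r ∈ E ∨ θ + (r - 1) ∈ E)} ⊆ ⋃ l, A l := by
    rintro θ ⟨hθ, hθ'⟩
    have hτE : τ θ ∈ E := by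
      rcases hθ' with h | h
      · have : θ + r < 1 := h.1.2
        simpa [τ, this] using h
      · have : ¬ θ + r < 1 := by have := h.1.1; linarith
        simpa [τ, this] using h
    obtain ⟨h01, n, hn1, hnM, hn⟩ := hθ
    obtain ⟨h01', n', hn1', hnM', hn'⟩ := hτE
    obtain ⟨j, hj⟩ := exists_fast_return_eq hξ₀ hcrit hφb hα hξ (hsq' _ h01) hn1 hnM
      (hret _ h01 n hn)
    obtain ⟨j', hj'⟩ := exists_fast_return_eq hξ₀ hcrit hφb hα hξ (hsq' _ h01') hn1' hnM'
      (hret _ h01' n' hn')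
    exact mem_iUnion.2 ⟨((j, j'), (fun i => 0 ≤ fn a d φ α (N + i + 1) θ (X θ),
      fun i => 0 ≤ fn a d φ α (N + i + 1) (τ θ) (X (τ θ)))),
      h01, h01', hj, hj', fun i => Iff.rfl, fun i => Iff.rfl⟩
  have hinter : volume {θ | θ ∈ E ∧ (θ + r ∈ E ∨ θ + (r - 1) ∈ E)} ≤ 1 / 3 := by
    refine (measure_mono hcover).trans ((measure_iUnion_fintype_le _ _).trans ?_)
    refine (Finset.sum_le_sum fun l _ => hA l).trans ?_
    rw [Finset.sum_const, Finset.card_univ, nsmul_eq_mul]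
    change κ * (3 * (κ + 1))⁻¹ ≤ 1 / 3
    rw [ENNReal.mul_inv (by simp) (by simp), mul_left_comm, one_div]
    refine mul_le_of_le_one_right' ?_
    rw [← div_eq_mul_inv]
    exact ENNReal.div_le_of_le_mul (by simp)
  have h2 := (two_mul_volume_le (measurableSet_fastReturns (N + M)) (fun θ hθ => hθ.1) hr01).trans
    (add_le_add_right hinter 1)
  have h3 : (1 : ℝ≥0∞) + 1 / 3 = 2 * (2 / 3) := by
    rw [← ENNReal.toReal_eq_toReal_iff' (by simp) (by finiteness),
      ENNReal.toReal_add (by simp) (by simp)]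
    norm_num
  rw [h3] at h2
  exact (ENNReal.mul_le_mul_iff_right (by norm_num) (by norm_num)).1 h2

open Classical in
lemma infinite_or_lt_ncard_iff {p : ℕ → Prop} {k : ℕ} :
    ({n | p n}.Infinite ∨ k < {n | p n}.ncard) ↔ ∃ m, p m ∧ Nat.count p m = k := by
  constructor
  · intro h
    have hk : ∀ hf : (Set.ofPred p).Finite, k < hf.toFinset.card := by
      intro hf
      rcases h with h | h
      · exact absurd hf h
      · rwa [Set.ncard_eq_toFinset_card _ hf] at h
    exact ⟨Nat.nth p k, Nat.nth_mem k hk, Nat.count_nth hk⟩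
  · rintro ⟨m, hm, rfl⟩
    by_cases hf : {n | p n}.Finite
    · refine Or.inr ?_
      rw [Set.ncard_eq_toFinset_card _ hf]
      exact Nat.count_lt_card hf hm
    · exact Or.inl hf

open Classical in
lemma nth_succ_of_first {p : ℕ → Prop} (h0 : p 0) {n : ℕ} (hn : 1 ≤ n)
    (hfirst : ∀ k, 1 ≤ k → k < n → ¬ p k) {i : ℕ}
    (h : {m | p m}.Infinite ∨ i + 1 < {m | p m}.ncard) :
    ({k | p (n + k)}.Infinite ∨ i < {k | p (n + k)}.ncard) ∧
      Nat.nth p (i + 1) = n + Nat.nth (fun k => p (n + k)) i := by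
  obtain ⟨m, hm, hmi⟩ := infinite_or_lt_ncard_iff.1 h
  have hnm : n ≤ m := by
    by_contra! hlt
    rcases Nat.eq_zero_or_pos m with rfl | hpos
    · simp at hmi
    · exact hfirst m hpos hlt hm
  obtain ⟨k, rfl⟩ := Nat.exists_eq_add_of_le hnm
  have hn1 : Nat.count p n = 1 := by
    rw [Nat.count_eq_card_filter_range]
    have : (Finset.range n).filter p = {0} := by
      ext l
      simp only [Finset.mem_filter, Finset.mem_range, Finset.mem_singleton]
      constructor
      · rintro ⟨h1, h2⟩
        by_contra h3
        exact hfirst l (Nat.one_le_iff_ne_zero.2 h3) h1 h2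
      · rintro rfl
        exact ⟨hn, h0⟩
    rw [this, Finset.card_singleton]
  have hk : Nat.count (fun k => p (n + k)) k = i := by
    rw [Nat.count_add, hn1] at hmi
    omega
  refine ⟨infinite_or_lt_ncard_iff.2 ⟨k, hm, hk⟩, ?_⟩
  rw [← hmi, ← hk, Nat.nth_count hm, Nat.nth_count (p := fun k => p (n + k)) hm]

section ReturnDecomposition

variable {a : ℝ} {d : ℕ} {φ : ℝ → ℝ} {α : ℝ} {X : ℝ → ℝ}

lemma floor_mul_pow_congr (hd : 0 < d) {k n : ℕ} (hkn : k ≤ n) {s t : ℝ}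
    (h : ⌊s * (d : ℝ) ^ n⌋ = ⌊t * (d : ℝ) ^ n⌋) : ⌊s * (d : ℝ) ^ k⌋ = ⌊t * (d : ℝ) ^ k⌋ := by
  have key : ∀ x : ℝ, ⌊x * (d : ℝ) ^ k⌋ = ⌊x * (d : ℝ) ^ n⌋ / ((d ^ (n - k) : ℕ) : ℤ) := by
    intro x
    rw [← Int.floor_div_natCast]
    congr 1
    have hd' : (d : ℝ) ≠ 0 := by positivity
    rw [← Nat.add_sub_cancel' hkn, pow_add]
    simp only [Nat.add_sub_cancel_left]
    push_cast
    field_simp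
  rw [key, key, h]

lemma floor_eq_iff_mem_Ico {n j : ℕ} {θ : ℝ} :
    ⌊θ * (d : ℝ) ^ n⌋ = (j : ℤ) ↔ (d : ℝ) ^ n * θ - j ∈ Ico (0 : ℝ) 1 := by
  rw [Int.floor_eq_iff, mem_Ico, mul_comm]
  push_cast
  constructor <;> rintro ⟨h1, h2⟩ <;> constructor <;> linarith

lemma isRet_rescale (hd : 0 < d) (hp : Function.Periodic φ 1) {n j : ℕ} (hn : 1 ≤ n)
    (hj : j < d ^ n) {t : ℝ} (ht : t ∈ Ico (0 : ℝ) 1)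
    (h : IsRet a d φ α X ((t + j) / (d : ℝ) ^ n) n) (k : ℕ) :
    IsRet a d φ α (rescale a d φ α X n j) t k ↔
      IsRet a d φ α X ((t + j) / (d : ℝ) ^ n) (n + k) := by
  have hpos : (0 : ℝ) < (d : ℝ) ^ n := by positivity
  rcases Nat.eq_zero_or_pos k with rfl | hk
  · exact ⟨fun _ => h, fun _ => Or.inl rfl⟩
  have hfl : ∀ s : ℝ, ⌊(s + j) / (d : ℝ) ^ n * (d : ℝ) ^ (n + k)⌋ =
      ⌊s * (d : ℝ) ^ k⌋ + ((j * d ^ k : ℕ) : ℤ) := by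
    intro s
    rw [← Int.floor_add_natCast]
    congr 1
    push_cast
    rw [pow_add]
    field_simp
  rw [IsRet, IsRet, or_iff_right (by omega), or_iff_right (by omega)]
  refine and_congr ⟨fun _ => by omega, fun _ => hk⟩ ⟨?_, ?_⟩
  · rintro ⟨t', ht', h1, h2⟩
    refine ⟨(t' + j) / (d : ℝ) ^ n, div_pow_mem_Ico hd hj ht', ?_, ?_⟩
    · rw [hfl, hfl, h1]
    · rwa [fn_rescale hd hp, add_comm k] at h2
  · rintro ⟨θ', hθ', h1, h2⟩
    have hj' : ⌊(t + j) / (d : ℝ) ^ n * (d : ℝ) ^ n⌋ = (j : ℤ) := by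
      rwa [floor_eq_iff_mem_Ico, mul_div_cancel₀ _ hpos.ne', add_sub_cancel_right]
    obtain ⟨t', rfl⟩ : ∃ t', θ' = (t' + j) / (d : ℝ) ^ n :=
      ⟨(d : ℝ) ^ n * θ' - j, by field_simp; ring⟩
    have ht' : t' ∈ Ico (0 : ℝ) 1 := by
      have := floor_eq_iff_mem_Ico.1 ((floor_mul_pow_congr hd (by omega) h1).trans hj')
      rwa [mul_div_cancel₀ _ hpos.ne', add_sub_cancel_right] at this
    refine ⟨t', ht', ?_, ?_⟩
    · rw [hfl, hfl] at h1
      exact add_right_cancel h1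
    · rwa [fn_rescale hd hp, add_comm k]

/-- The parameters whose return times of index `i` and `i + 1` differ by at most `B`, for every
`i ∈ S`. -/
def fastReturnsAt (a : ℝ) (d : ℕ) (φ : ℝ → ℝ) (α : ℝ) (X : ℝ → ℝ) (B : ℕ) (S : Finset ℕ) :
    Set ℝ :=
  {θ | θ ∈ Ico (0 : ℝ) 1 ∧ ∀ i ∈ S, NkDef a d φ α X θ (i + 1) ∧
    nk a d φ α X θ (i + 1) - nk a d φ α X θ i ≤ B}

lemma NkDef.exists_first {θ : ℝ} {i : ℕ} (h : NkDef a d φ α X θ (i + 1)) :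
    ∃ n, 1 ≤ n ∧ IsRet a d φ α X θ n ∧ ∀ k, 1 ≤ k → k < n → ¬ IsRet a d φ α X θ k := by
  classical
  obtain ⟨m, hm, hmi⟩ := infinite_or_lt_ncard_iff.1 h
  have hex : ∃ n, 1 ≤ n ∧ IsRet a d φ α X θ n := by
    refine ⟨m, ?_, hm⟩
    rcases Nat.eq_zero_or_pos m with rfl | hpos
    · simp at hmi
    · exact hpos
  exact ⟨Nat.find hex, (Nat.find_spec hex).1, (Nat.find_spec hex).2,
    fun k h1 h2 h3 => Nat.find_min hex h2 ⟨h1, h3⟩⟩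

/-- Return times after the first one are the first one plus return times of the rescaled curve. -/
lemma NkDef.tail (hd : 0 < d) (hp : Function.Periodic φ 1) {n j : ℕ} (hn : 1 ≤ n)
    (hj : j < d ^ n) {t : ℝ} (ht : t ∈ Ico (0 : ℝ) 1)
    (hret : IsRet a d φ α X ((t + j) / (d : ℝ) ^ n) n)
    (hfirst : ∀ k, 1 ≤ k → k < n → ¬ IsRet a d φ α X ((t + j) / (d : ℝ) ^ n) k) {i : ℕ}
    (h : NkDef a d φ α X ((t + j) / (d : ℝ) ^ n) (i + 1)) :
    NkDef a d φ α (rescale a d φ α X n j) t i ∧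
      nk a d φ α X ((t + j) / (d : ℝ) ^ n) (i + 1) =
        n + nk a d φ α (rescale a d φ α X n j) t i := by
  have heq : (fun k => IsRet a d φ α X ((t + j) / (d : ℝ) ^ n) (n + k)) =
      IsRet a d φ α (rescale a d φ α X n j) t :=
    funext fun k => propext (isRet_rescale hd hp hn hj ht hret k).symm
  have := nth_succ_of_first (Or.inl rfl) hn hfirst h
  refine ⟨?_, ?_⟩
  · simpa only [NkDef, isRet_rescale hd hp hn hj ht hret] using this.1
  · rw [nk, nk, this.2, heq]

lemma NkDef.mono {θ : ℝ} {i k : ℕ} (h : NkDef a d φ α X θ k) (hik : i ≤ k) :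
    NkDef a d φ α X θ i :=
  h.imp_right hik.trans_lt

lemma nk_zero {θ : ℝ} : nk a d φ α X θ 0 = 0 := Nat.nth_zero_of_zero (Or.inl rfl)

lemma volume_preimage_mul_pow_sub (hd : 0 < d) (n j : ℕ) (s : Set ℝ) :
    volume ((fun θ => (d : ℝ) ^ n * θ - j) ⁻¹' s) =
      ENNReal.ofReal |((d : ℝ) ^ n)⁻¹| * volume s := by
  have hpos : (0 : ℝ) < (d : ℝ) ^ n := by positivity
  have : (fun θ => (d : ℝ) ^ n * θ - j) ⁻¹' s =
      (fun θ => (d : ℝ) ^ n * θ) ⁻¹' ((fun x => x + -(j : ℝ)) ⁻¹' s) := rfl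
  rw [this, Real.volume_preimage_mul_left hpos.ne', measure_preimage_add_right]

lemma volume_fastReturnsAt_le_mul (hd : 0 < d) (hp : Function.Periodic φ 1) {B : ℕ}
    {S S' : Finset ℕ} (hS : S.Nonempty) (hS' : ∀ i ∈ S', i + 1 ∈ S) {c C : ℝ≥0∞}
    (hC : ∀ n j : ℕ, 1 ≤ n → j < d ^ n →
      (∀ t ∈ Ico (0 : ℝ) 1, IsRet a d φ α X ((t + j) / (d : ℝ) ^ n) n) →
      volume (fastReturnsAt a d φ α (rescale a d φ α X n j) B S') ≤ C)
    (h1 : 1 ≤ c ∨ 0 ∈ S ∧ volume (fastReturns a d φ α X B) ≤ c) :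
    volume (fastReturnsAt a d φ α X B S) ≤ C * c := by
  let T : Set (ℕ × ℕ) := {l | 1 ≤ l.1 ∧ l.2 < d ^ l.1 ∧ ∀ t ∈ Ico (0 : ℝ) 1,
    IsRet a d φ α X ((t + l.2) / (d : ℝ) ^ l.1) l.1 ∧
    (∀ k, 1 ≤ k → k < l.1 → ¬ IsRet a d φ α X ((t + l.2) / (d : ℝ) ^ l.1) k) ∧
    (0 ∈ S → l.1 ≤ B)}
  let g : ℕ × ℕ → ℝ → ℝ := fun l θ => (d : ℝ) ^ l.1 * θ - l.2
  have hg : ∀ l θ, (g l θ + l.2) / (d : ℝ) ^ l.1 = θ := by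
    intro l θ
    have : (d : ℝ) ≠ 0 := by positivity
    simp only [g]
    field_simp
    ring
  let cell : ℕ × ℕ → Set ℝ := fun l => g l ⁻¹' Ico 0 1
  have hgm : ∀ l, Measurable (g l) := fun l => by fun_prop
  have hcover : fastReturnsAt a d φ α X B S ⊆
      ⋃ l : T, g l ⁻¹' fastReturnsAt a d φ α (rescale a d φ α X l.1.1 l.1.2) B S' := by
    rintro θ ⟨hθ, hall⟩
    obtain ⟨i₀, hi₀⟩ := hS
    obtain ⟨n, hn, hret, hfirst⟩ := (hall i₀ hi₀).1.exists_first
    have hpos : (0 : ℝ) < (d : ℝ) ^ n := by positivity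
    obtain ⟨j, hj⟩ := Int.eq_ofNat_of_zero_le
      (Int.floor_nonneg.2 (mul_nonneg hθ.1 hpos.le) : 0 ≤ ⌊θ * (d : ℝ) ^ n⌋)
    have hjn : j < d ^ n := by
      have h2 : ⌊θ * (d : ℝ) ^ n⌋ < ((d ^ n : ℕ) : ℤ) := by
        rw [Int.floor_lt]
        push_cast
        exact mul_lt_of_lt_one_left hpos hθ.2
      rw [hj] at h2
      exact_mod_cast h2
    have hgθ : g (n, j) θ ∈ Ico (0 : ℝ) 1 := floor_eq_iff_mem_Ico.1 hj
    have hmem : (n, j) ∈ T := by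
      refine ⟨hn, hjn, fun t ht => ?_⟩
      have hfl : ⌊(t + j) / (d : ℝ) ^ n * (d : ℝ) ^ n⌋ = ⌊θ * (d : ℝ) ^ n⌋ := by
        rw [hj]
        refine floor_eq_iff_mem_Ico.2 ?_
        rwa [mul_div_cancel₀ _ hpos.ne', add_sub_cancel_right]
      refine ⟨(isRet_congr hfl).2 hret, fun k hk hkn h => hfirst k hk hkn ?_, fun h0 => ?_⟩
      · exact (isRet_congr (floor_mul_pow_congr hd hkn.le hfl)).1 h
      · have h3 := hall 0 h0
        rw [← hg (n, j) θ] at h3 hret hfirst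
        rw [(NkDef.tail hd hp hn hjn hgθ hret hfirst h3.1).2, nk_zero, nk_zero] at h3
        simpa using h3.2
    refine mem_iUnion.2 ⟨⟨(n, j), hmem⟩, hgθ, fun i hi => ?_⟩
    have h4 := hall (i + 1) (hS' i hi)
    rw [← hg (n, j) θ] at h4 hret hfirst
    have h5 := NkDef.tail hd hp hn hjn hgθ hret hfirst h4.1
    have h6 := NkDef.tail hd hp hn hjn hgθ hret hfirst (h4.1.mono (Nat.le_succ _))
    refine ⟨h5.1, ?_⟩
    have h7 := h4.2
    rwa [h5.2, h6.2, Nat.add_sub_add_left] at h7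
  have hdisj : Pairwise (Function.onFun Disjoint fun l : T => cell l) := by
    intro l l' hne
    rw [Function.onFun, Set.disjoint_left]
    intro θ h h'
    apply hne
    have hr := (l.2.2.2 _ h)
    have hr' := (l'.2.2.2 _ h')
    rw [hg] at hr hr'
    have hn : l.1.1 = l'.1.1 := by
      rcases lt_trichotomy l.1.1 l'.1.1 with hlt | heq | hlt
      · exact absurd hr.1 (hr'.2.1 _ l.2.1 hlt)
      · exact heq
      · exact absurd hr'.1 (hr.2.1 _ l'.2.1 hlt)
    have hj := floor_eq_iff_mem_Ico.2 h
    have hj' := floor_eq_iff_mem_Ico.2 h'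
    rw [← hn, hj] at hj'
    exact Subtype.ext (Prod.ext hn (by exact_mod_cast hj'))
  have hcell : ∀ l : T, volume (g l ⁻¹'
      fastReturnsAt a d φ α (rescale a d φ α X l.1.1 l.1.2) B S') ≤ C * volume (cell l) := by
    intro l
    have h2 := hC l.1.1 l.1.2 l.2.1 l.2.2.1 fun t ht => (l.2.2.2 t ht).1
    simp only [cell, g]
    rw [volume_preimage_mul_pow_sub hd, volume_preimage_mul_pow_sub hd, Real.volume_Ico, sub_zero,
      ENNReal.ofReal_one, mul_one, mul_comm]
    exact mul_le_mul_left h2 _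
  have hmem01 : ∀ l : T, ∀ θ ∈ cell l, θ ∈ Ico (0 : ℝ) 1 := by
    intro l θ h
    have := div_pow_mem_Ico hd l.2.2.1 h
    rwa [hg] at this
  have htotal : volume (⋃ l : T, cell l) ≤ c := by
    rcases h1 with h1 | ⟨h0, h1⟩
    · refine le_trans (measure_mono (iUnion_subset hmem01)) (le_trans ?_ h1)
      simp
    · refine le_trans (measure_mono (iUnion_subset fun l θ h => ?_)) h1
      have h3 := l.2.2.2 _ h
      rw [hg] at h3
      exact ⟨hmem01 l θ h, l.1.1, l.2.1, h3.2.2 h0, h3.1⟩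
  calc volume (fastReturnsAt a d φ α X B S)
      ≤ ∑' l : T, C * volume (cell l) :=
        (measure_mono hcover).trans ((measure_iUnion_le _).trans (ENNReal.tsum_le_tsum hcell))
    _ = C * volume (⋃ l : T, cell l) := by
        rw [ENNReal.tsum_mul_left, measure_iUnion hdisj fun l => hgm l measurableSet_Ico]
    _ ≤ C * c := by gcongr

lemma volume_fastReturnsAt_le (hd : 0 < d) (hp : Function.Periodic φ 1) {B : ℕ} {ρ : ℝ≥0∞}
    {G : (ℝ → ℝ) → Prop}
    (hG : ∀ X, G X → ∀ n j : ℕ, 1 ≤ n → j < d ^ n →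
      (∀ t ∈ Ico (0 : ℝ) 1, IsRet a d φ α X ((t + j) / (d : ℝ) ^ n) n) →
      G (rescale a d φ α X n j))
    (hρ : ∀ X, G X → volume (fastReturns a d φ α X B) ≤ ρ) (S : Finset ℕ) (hX : G X) :
    volume (fastReturnsAt a d φ α X B S) ≤ ρ ^ S.card := by
  obtain ⟨K, hK⟩ : ∃ K, S ⊆ Finset.range K := ⟨S.sup id + 1, S.subset_range_sup_succ⟩
  induction K generalizing S X with
  | zero =>
    rw [Finset.range_zero, Finset.subset_empty] at hK
    subst hK
    refine (measure_mono fun θ hθ => hθ.1).trans (b := volume (Ico (0 : ℝ) 1)) ?_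
    simp
  | succ K ih =>
    rcases S.eq_empty_or_nonempty with rfl | hS
    · exact ih ∅ hX (by simp)
    let S' := (S.erase 0).image fun i => i - 1
    have hcard : S'.card = (S.erase 0).card := by
      apply Finset.card_image_of_injOn
      intro i hi j hj hij
      have := Finset.ne_of_mem_erase hi
      have := Finset.ne_of_mem_erase hj
      simp only at hij
      omega
    have hS' : ∀ i ∈ S', i + 1 ∈ S := by
      intro i hi
      obtain ⟨j, hj, rfl⟩ := Finset.mem_image.1 hi
      have := Finset.ne_of_mem_erase hj
      rw [Nat.sub_add_cancel (by omega)]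
      exact Finset.mem_of_mem_erase hj
    have hS'K : S' ⊆ Finset.range K := fun i hi => by
      have := Finset.mem_range.1 (hK (hS' i hi))
      exact Finset.mem_range.2 (by omega)
    have hstep := fun n j (hn : 1 ≤ n) hj hret => ih S' (hG X hX n j hn hj hret) hS'K
    by_cases h0 : 0 ∈ S
    · rw [← Finset.card_erase_add_one h0, ← hcard, pow_succ]
      exact volume_fastReturnsAt_le_mul hd hp hS hS' hstep (Or.inr ⟨h0, hρ X hX⟩)
    · rw [Finset.erase_eq_of_notMem h0] at hcard
      rw [← hcard, ← mul_one (ρ ^ S'.card)]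
      exact volume_fastReturnsAt_le_mul hd hp hS hS' hstep (Or.inl le_rfl)

end ReturnDecomposition

/-- Given `M > 0`, for `α > 0` small enough: for any finite strictly
increasing sequence `0 ≤ k₁ < ⋯ < k_t`, the set
`𝒟(k₁,…,k_t) = {θ ∈ [0,1) : n_{k_i+1}(θ) - n_{k_i}(θ) ≤ N(α) + M for 1 ≤ i ≤ t}`
has Lebesgue measure at most `(2/3)^t`. -/
theorem consecutive_fast_returns_bound
    (a : ℝ) (ha : a ∈ Set.Ioo (1 : ℝ) 2) (hpre : StrictlyPreperiodic a)
    (d : ℕ) (hd : 2 ≤ d)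
    (φ : ℝ → ℝ) (hφa : ∀ x : ℝ, AnalyticAt ℝ φ x) (hφp : Function.Periodic φ 1)
    (hφnc : ∃ s t : ℝ, φ s ≠ φ t) (hφb : ∀ θ : ℝ, |φ θ| ≤ 1)
    (β : ℝ) (hβ1 : 1 < β) (hβ2 : β < |(-1 - Real.sqrt (1 + 4 * a)) / 2|)
    (hβmap : ∀ x ∈ Set.Icc (-β) β, qm a x ∈ Set.Ioo (-β) β)
    (hβder : ∀ x : ℝ, β ≤ |x| → 2 * β ≤ |deriv (qm a) x|)
    (n₀ : ℕ)
    (hdom : ∃ C₁ R₁ : ℝ, 0 < C₁ ∧ R₁ ∈ Set.Ioo (0 : ℝ) 2 ∧ ∃ α₁ > 0, ∀ α : ℝ, 0 < α → α < α₁ →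
      ∀ θ x : ℝ, x ∈ Set.Icc (-β) β → ∀ k : ℕ,
        |deriv (fun y => fn a d φ α k θ y) x| ≤ C₁ * R₁ ^ k ∧
        (n₀ ≤ k → |deriv (fun y => fn a d φ α k θ y) x| ≤ R₁ ^ k ∧ R₁ ^ k ≤ (d : ℝ) ^ k / 6))
    (ξ₀ : ℝ) (hξ₀ : 0 < ξ₀)
    (hcrit : ∀ i : ℕ, 1 ≤ i → (qm a)^[i] 0 ∉ Set.Ioo (-(2 * ξ₀)) (2 * ξ₀))
    :
    ∀ M : ℕ, 0 < M → ∃ α₀ > 0, ∀ α : ℝ, 0 < α → α < α₀ → α ≤ ξ₀ →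
      ∀ X : ℝ → ℝ, Admissible a d φ α β n₀ X →
        Set.MapsTo X (Set.Ico (0 : ℝ) 1)
          (Set.Icc (-(2 * α ^ (0.6 : ℝ))) (2 * α ^ (0.6 : ℝ))) →
        ∀ (t : ℕ) (ks : Fin t → ℕ), StrictMono ks →
          volume {θ : ℝ | θ ∈ Set.Ico (0 : ℝ) 1 ∧ ∀ i : Fin t,
              NkDef a d φ α X θ (ks i + 1) ∧
              nk a d φ α X θ (ks i + 1) - nk a d φ α X θ (ks i) ≤ Nal a ξ₀ α + M} ≤
            (2 / 3 : ℝ≥0∞) ^ t := by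
  intro M _
  obtain ⟨c, σ, hc, hσ, hgrow⟩ := exists_growth ha hpre
  obtain ⟨C, R, hC, hR, α₁, hα₁, hder⟩ := hdom
  obtain ⟨L, hL0, hL⟩ := exists_lipschitz_of_analytic_periodic hφa hφp
  obtain ⟨α₂, hα₂, hB⟩ := exists_fn_mem_Icc hβ1 hβmap hφb d
  obtain ⟨α₃, hα₃, hfast⟩ :=
    exists_volume_fastReturns_le hξ₀ hcrit hc hσ hgrow hd hφa hφp hφnc hφb M
  have hd0 : 0 < d := by omega
  have hdR : 0 < (d : ℝ) - R := by
    have : (2 : ℝ) ≤ d := by exact_mod_cast hd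
    linarith [hR.2]
  set D := L * C / (d - R) with hD
  have hD0 : 0 < D := by positivity
  obtain ⟨α₄, hα₄, hsmall⟩ := exists_rpow_lt (p := 0.4) (ε := D⁻¹) (by norm_num) (by positivity)
  refine ⟨min (min α₁ α₂) (min α₃ α₄), by positivity, ?_⟩
  intro α hα hlt _ X hX hXB t ks hks
  obtain ⟨⟨h₁, h₂⟩, h₃, h₄⟩ : (α < α₁ ∧ α < α₂) ∧ α < α₃ ∧ α < α₄ := by
    simpa only [lt_min_iff] using hlt
  have hDα : D * α ≤ α ^ (0.6 : ℝ) := by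
    have h5 : D * α ^ (0.4 : ℝ) ≤ 1 := by
      rw [mul_comm, ← le_div_iff₀ hD0, one_div]
      exact (hsmall α hα h₄).le
    have h6 : α = α ^ (0.4 : ℝ) * α ^ (0.6 : ℝ) := by
      rw [← Real.rpow_add hα]
      norm_num
    calc D * α = D * α ^ (0.4 : ℝ) * α ^ (0.6 : ℝ) := by rw [mul_assoc, ← h6]
      _ ≤ α ^ (0.6 : ℝ) := mul_le_of_le_one_left (by positivity) h5
  have hdist := abs_fn_sub_fn_le hd hα hL hL0 hC hR (hB α hα h₂)
    fun θ x hx k => (hder α hα h₁ θ x hx k).1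
  have hnear : ∀ Y, Admissible a d φ α β n₀ Y ∧ MapsTo Y (Ico (0 : ℝ) 1)
      (Icc (-(2 * α ^ (0.6 : ℝ))) (2 * α ^ (0.6 : ℝ))) →
      ∀ θ ∈ Ico (0 : ℝ) 1, ∀ n, IsRet a d φ α Y θ n →
        |fn a d φ α n θ (Y θ)| ≤ 2 * α ^ (0.6 : ℝ) := fun Y hY θ hθ n hn =>
    hn.abs_fn_le hd0 hφp hα hY.1 hY.2 hD0 hdist hDα hθ
  have hmain := volume_fastReturnsAt_le hd0 hφp (B := Nal a ξ₀ α + M) (ρ := 2 / 3)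
    (G := fun Y => Admissible a d φ α β n₀ Y ∧ MapsTo Y (Ico (0 : ℝ) 1)
      (Icc (-(2 * α ^ (0.6 : ℝ))) (2 * α ^ (0.6 : ℝ))))
    (fun Y hY n j _ hj hret => ⟨hY.1.rescale hd0 hφp hj, fun t ht =>
      abs_le.1 (hnear Y hY _ (div_pow_mem_Ico hd0 hj ht) n (hret t ht))⟩)
    (fun Y hY => hfast α hα h₃ Y (fun θ hθ => abs_le.2 (hY.2 hθ)) (hnear Y hY))
    (Finset.univ.image ks) ⟨hX, hXB⟩
  rw [Finset.card_image_of_injective _ hks.injective, Finset.card_fin] at hmain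
  refine le_trans (measure_mono ?_) hmain
  rintro θ ⟨hθ, hall⟩
  refine ⟨hθ, fun i hi => ?_⟩
  obtain ⟨l, -, rfl⟩ := Finset.mem_image.1 hi
  exact hall l
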